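/- arXiv:2011.04483 — 3 statements merged into one kernel-verified Lean document; each statement's English description precedes it below -/
import Mathlib

section
/- Lemma 4.3: Let 𝒳 be a Polish space and ℋ a concept class. Let Ŷ_t : (𝒳 × {0,1})^{t-1} × 𝒳 → {0,1} (t ≥ 1) be universally measurable functions defining an online learner with the following two properties: (i) for every sequence (x_1,y_1,x_2,y_2,…) consistent with ℋ, the learner makes only finitely many mistakes, i.e., Ŷ_t(x_1,y_1,…,x_{t-1},y_{t-1},x_t) ≠ y_t for only finitely many t; (ii) the predictor changes only when a mistake is made, i.e., if Ŷ_t(x_1,y_1,…,x_{t-1},y_{t-1},x_t) = y_t then Ŷ_{t+1}(x_1,y_1,…,x_t,y_t,·) = Ŷ_t(x_1,y_1,…,x_{t-1},y_{t-1},·) as functions on 𝒳. Then for every realizable distribution P, with (X_1,Y_1),(X_2,Y_2),… drawn i.i.d. from P and ŷ_t := Ŷ_{t+1}(X_1,Y_1,…,X_t,Y_t,·), one has P{er_P(ŷ_t) > 0} → 0 as t → ∞. -/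
open scoped ENNReal

/-- A function is universally measurable if it is measurable with respect to (the completion of)
every Borel probability measure on its domain. -/
def UniversallyMeasurable {α β : Type*} [MeasurableSpace α] [MeasurableSpace β] (f : α → β) : Prop :=
  ∀ μ : MeasureTheory.Measure α, MeasureTheory.IsProbabilityMeasure μ →
    MeasureTheory.NullMeasurable f μ

variable {𝒳 : Type*}

/-- The error of a classifier `h` under distribution `P` on `𝒳 × {0,1}`. -/
noncomputable def errP [MeasurableSpace 𝒳] (P : MeasureTheory.Measure (𝒳 × Bool))
    (h : 𝒳 → Bool) : ℝ≥0∞ :=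
  P {p : 𝒳 × Bool | h p.1 ≠ p.2}

/-- `P` is realizable w.r.t. the concept class `ℋ`: `inf_{h ∈ ℋ} er_P(h) = 0`. -/
def Realizable [MeasurableSpace 𝒳] (ℋ : Set (𝒳 → Bool))
    (P : MeasureTheory.Measure (𝒳 × Bool)) : Prop :=
  (⨅ h ∈ ℋ, errP P h) = 0

/-- A learning algorithm: a sequence of universally measurable maps
`H_n : (𝒳 × {0,1})^n × 𝒳 → {0,1}`. -/
structure LearningAlgorithm (𝒳 : Type*) [MeasurableSpace 𝒳] where
  H : ∀ n : ℕ, (Fin n → 𝒳 × Bool) → 𝒳 → Bool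
  meas : ∀ n : ℕ, UniversallyMeasurable fun q : (Fin n → 𝒳 × Bool) × 𝒳 => H n q.1 q.2

/-- Expected error `E[er_P(ĥ_n)]` of the output of a learning algorithm on an i.i.d. sample of
size `n` from `P`, i.e. integration with respect to `P^{⊗n}`. -/
noncomputable def expErr [MeasurableSpace 𝒳] (P : MeasureTheory.Measure (𝒳 × Bool))
    (A : LearningAlgorithm 𝒳) (n : ℕ) : ℝ≥0∞ :=
  MeasureTheory.lintegral (MeasureTheory.Measure.pi fun _ : Fin n => P)
    fun s => errP P (A.H n s)

/-- A rate function: `R : ℕ → [0,1]` with `R(n) → 0`. -/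
def IsRate (R : ℕ → ℝ) : Prop :=
  (∀ n, R n ∈ Set.Icc (0 : ℝ) 1) ∧ Filter.Tendsto R Filter.atTop (nhds 0)

/-- `ℋ` is learnable at rate `R`. -/
def LearnableAtRate [MeasurableSpace 𝒳] (ℋ : Set (𝒳 → Bool)) (R : ℕ → ℝ) : Prop :=
  ∃ A : LearningAlgorithm 𝒳,
    ∀ P : MeasureTheory.Measure (𝒳 × Bool),
      MeasureTheory.IsProbabilityMeasure P → Realizable ℋ P →
        ∃ C > (0 : ℝ), ∃ c > (0 : ℝ), ∀ n : ℕ,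
          expErr P A n ≤ ENNReal.ofReal (C * R ⌈c * (n : ℝ)⌉₊)

/-- `ℋ` is not learnable at rate faster than `R`. -/
def NotLearnableFasterThan [MeasurableSpace 𝒳] (ℋ : Set (𝒳 → Bool)) (R : ℕ → ℝ) : Prop :=
  ∀ A : LearningAlgorithm 𝒳,
    ∃ P : MeasureTheory.Measure (𝒳 × Bool),
      MeasureTheory.IsProbabilityMeasure P ∧ Realizable ℋ P ∧
        ∃ C > (0 : ℝ), ∃ c > (0 : ℝ),
          {n : ℕ | ENNReal.ofReal (C * R ⌈c * (n : ℝ)⌉₊) ≤ expErr P A n}.Infinite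

/-- `ℋ` is learnable with optimal rate `R`. -/
def LearnableWithOptimalRate [MeasurableSpace 𝒳] (ℋ : Set (𝒳 → Bool)) (R : ℕ → ℝ) : Prop :=
  LearnableAtRate ℋ R ∧ NotLearnableFasterThan ℋ R

/-- `ℋ` requires arbitrarily slow rates. -/
def RequiresArbitrarilySlowRates [MeasurableSpace 𝒳] (ℋ : Set (𝒳 → Bool)) : Prop :=
  ∀ R : ℕ → ℝ, IsRate R → NotLearnableFasterThan ℋ R

/-- Witness that `ℋ` is a measurable class: it is parameterized by a Polish space `Θ` via a
Borel measurable map `𝗁 : Θ × 𝒳 → {0,1}`. -/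
structure MeasurableClassWitness (𝒳 : Type*) [MeasurableSpace 𝒳] (ℋ : Set (𝒳 → Bool)) where
  Θ : Type
  [tΘ : TopologicalSpace Θ]
  [mΘ : MeasurableSpace Θ]
  [polish : PolishSpace Θ]
  [borel : BorelSpace Θ]
  f : Θ → 𝒳 → Bool
  meas : Measurable (Function.uncurry f)
  range_eq : ℋ = Set.range f

/-- `ℋ` is a measurable class (image admissible Suslin). -/
def MeasurableClass (𝒳 : Type*) [MeasurableSpace 𝒳] (ℋ : Set (𝒳 → Bool)) : Prop :=
  Nonempty (MeasurableClassWitness 𝒳 ℋ)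

/-- `ℋ` has an infinite Littlestone tree: nodes are indexed by finite binary strings, and every
finite branch is consistent with some concept in `ℋ`. -/
def HasInfiniteLittlestoneTree (ℋ : Set (𝒳 → Bool)) : Prop :=
  ∃ x : List Bool → 𝒳, ∀ (y : ℕ → Bool) (n : ℕ),
    ∃ h ∈ ℋ, ∀ k ≤ n, h (x (List.ofFn fun i : Fin k => y i)) = y k

/-- `ℋ` has an infinite VCL tree: the node at depth `k` along a branch is a `(k+1)`-tuple of
points, edges out of it are labelled by `{0,1}^{k+1}`, and every finite branch is consistent
with some concept in `ℋ`. -/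
def HasInfiniteVCLTree (ℋ : Set (𝒳 → Bool)) : Prop :=
  ∃ x : ∀ k : ℕ, (∀ j : Fin k, Fin (j.val + 1) → Bool) → Fin (k + 1) → 𝒳,
    ∀ (y : ∀ k : ℕ, Fin (k + 1) → Bool) (n : ℕ),
      ∃ h ∈ ℋ, ∀ k ≤ n, ∀ i : Fin (k + 1),
        h (x k (fun j => y j.val) i) = y k i

/-- A sequence `(x_t, y_t)` is consistent with `ℋ` if every finite prefix is consistent with
some concept in `ℋ`. -/
def ConsistentWith (ℋ : Set (𝒳 → Bool)) (x : ℕ → 𝒳) (y : ℕ → Bool) : Prop :=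
  ∀ t : ℕ, ∃ h ∈ ℋ, ∀ s ≤ t, h (x s) = y s

open MeasureTheory Filter Topology

section ProductMeasure

variable {Z : Type*} [MeasurableSpace Z] (P : Measure Z) [IsProbabilityMeasure P]

/-- Concatenating a sample of size `t` with an i.i.d. sequence yields an i.i.d. sequence. -/
lemma map_append_prod_infinitePi (t : ℕ) :
    ((Measure.pi fun _ : Fin t => P).prod (Measure.infinitePi fun _ : ℕ => P)).map
      (fun q i => if h : i < t then q.1 ⟨i, h⟩ else q.2 (i - t)) =
      Measure.infinitePi fun _ : ℕ => P := by
  classical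
  have hm : Measurable (fun (q : (Fin t → Z) × (ℕ → Z)) (i : ℕ) =>
      if h : i < t then q.1 ⟨i, h⟩ else q.2 (i - t)) := by
    refine measurable_pi_lambda _ fun i => ?_
    by_cases h : i < t
    · simp only [h, dite_true]; fun_prop
    · simp only [h, dite_false]; fun_prop
  refine Measure.eq_infinitePi _ fun I A hA => ?_
  obtain ⟨N, hN⟩ : ∃ N, I ⊆ Finset.range (t + N) := by
    refine ⟨I.sup id + 1, fun i hi => ?_⟩
    have : i ≤ I.sup id := Finset.le_sup (f := id) hi
    simp only [Finset.mem_range]; omega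
  set B : ℕ → Set Z := fun i => if i ∈ I then A i else Set.univ with hB
  have hBm : ∀ i, MeasurableSet (B i) := fun i => by
    by_cases h : i ∈ I <;> simp [hB, h, hA]
  have hpi : Set.pi (I : Set ℕ) A = Set.pi (Finset.range (t + N) : Set ℕ) B := by
    ext ω
    simp only [Set.mem_pi, Finset.mem_coe]
    constructor
    · intro h i _
      by_cases hi : i ∈ I
      · simpa [hB, hi] using h i hi
      · simp [hB, hi]
    · intro h i hi
      simpa [hB, hi] using h i (hN hi)
  have hprod : ∏ i ∈ I, P (A i) = ∏ i ∈ Finset.range (t + N), P (B i) := by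
    rw [← Finset.prod_subset hN (f := fun i => P (B i)) (fun i _ hi => by simp [hB, hi])]
    exact Finset.prod_congr rfl fun i hi => by simp [hB, hi]
  have hpre : (fun (q : (Fin t → Z) × (ℕ → Z)) (i : ℕ) =>
      if h : i < t then q.1 ⟨i, h⟩ else q.2 (i - t)) ⁻¹'
        Set.pi (Finset.range (t + N) : Set ℕ) B =
      (Set.univ.pi fun i : Fin t => B i) ×ˢ
        Set.pi (Finset.range N : Set ℕ) (fun n => B (t + n)) := by
    ext q
    simp only [Set.mem_preimage, Set.mem_pi, Finset.mem_coe, Finset.mem_range, Set.mem_prod,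
      Set.mem_univ, true_imp_iff]
    constructor
    · intro h
      refine ⟨fun i => ?_, fun n hn => ?_⟩
      · simpa using h i (by omega)
      · simpa using h (t + n) (by omega)
    · rintro ⟨h1, h2⟩ i hi
      by_cases hit : i < t
      · simpa [hit] using h1 ⟨i, hit⟩
      · have := h2 (i - t) (by omega)
        rw [Nat.add_sub_cancel' (not_lt.1 hit)] at this
        simpa [hit] using this
  rw [hpi, hprod, Measure.map_apply hm
    (MeasurableSet.pi (Finset.countable_toSet _) fun i _ => hBm i), hpre, Measure.prod_prod,
    Measure.pi_pi, Measure.infinitePi_pi _ (fun i _ => hBm _), Finset.prod_range_add,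
    Finset.prod_range (fun i => P (B i))]

/-- Splitting an i.i.d. sequence into its first `t` terms and the rest gives an independent
pair of an i.i.d. sample and an i.i.d. sequence. -/
lemma measurePreserving_split_infinitePi (t : ℕ) :
    MeasurePreserving (fun ω : ℕ → Z => ((fun i : Fin t => ω i), fun n : ℕ => ω (t + n)))
      (Measure.infinitePi fun _ : ℕ => P)
      ((Measure.pi fun _ : Fin t => P).prod (Measure.infinitePi fun _ : ℕ => P)) := by
  have hm : Measurable (fun (q : (Fin t → Z) × (ℕ → Z)) (i : ℕ) =>
      if h : i < t then q.1 ⟨i, h⟩ else q.2 (i - t)) := by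
    refine measurable_pi_lambda _ fun i => ?_
    by_cases h : i < t
    · simp only [h, dite_true]; fun_prop
    · simp only [h, dite_false]; fun_prop
  have hs : Measurable
      (fun ω : ℕ → Z => ((fun i : Fin t => ω i), fun n : ℕ => ω (t + n))) := by fun_prop
  refine ⟨hs, ?_⟩
  conv_lhs => rw [← map_append_prod_infinitePi P t]
  rw [Measure.map_map hs hm]
  convert Measure.map_id
  ext q <;> simp

/-- The first `t` terms and a single later term of an i.i.d. sequence. -/
lemma measurePreserving_sample_eval_infinitePi (t n : ℕ) :
    MeasurePreserving (fun ω : ℕ → Z => ((fun i : Fin t => ω i), ω (t + n)))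
      (Measure.infinitePi fun _ : ℕ => P) ((Measure.pi fun _ : Fin t => P).prod P) :=
  ((MeasurePreserving.id _).prod
    (measurePreserving_eval_infinitePi (fun _ : ℕ => P) n)).comp
      (measurePreserving_split_infinitePi P t)

/-- An i.i.d. sequence almost surely hits every measurable set of positive measure. -/
lemma ae_exists_mem_of_measure_pos {A : Set Z} (hA : MeasurableSet A) (hpos : 0 < P A) :
    ∀ᵐ τ ∂(Measure.infinitePi fun _ : ℕ => P), ∃ n, τ n ∈ A := by
  have hlt : P Aᶜ < 1 := by
    rw [prob_compl_eq_one_sub hA]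
    exact ENNReal.sub_lt_self ENNReal.one_ne_top one_ne_zero hpos.ne'
  rw [ae_iff]
  refine le_antisymm (ge_of_tendsto' (ENNReal.tendsto_pow_atTop_nhds_zero_of_lt_one hlt)
    fun N => ?_) zero_le
  calc _ ≤ Measure.infinitePi (fun _ : ℕ => P)
        (Set.pi (Finset.range N : Set ℕ) fun _ => Aᶜ) := by
        refine measure_mono fun τ hτ => ?_
        exact fun n _ hn => hτ ⟨n, hn⟩
    _ = P Aᶜ ^ N := by
        rw [Measure.infinitePi_pi _ (fun _ _ => hA.compl)]; simp

/-- Almost surely, if the section of a null-measurable set `D` at the first `t` terms has positive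
measure, then some later term of the sequence falls in this section. -/
lemma ae_exists_mem_section {t : ℕ} {D : Set ((Fin t → Z) × Z)}
    (hD : NullMeasurableSet D ((Measure.pi fun _ : Fin t => P).prod P)) :
    ∀ᵐ ω ∂(Measure.infinitePi fun _ : ℕ => P),
      0 < P {z | ((fun i : Fin t => ω i), z) ∈ D} →
        ∃ n, ((fun i : Fin t => ω i), ω (t + n)) ∈ D := by
  obtain ⟨D', -, hD', hDD'⟩ := hD.exists_measurable_superset_ae_eq
  have hmem : ∀ᵐ q ∂((Measure.pi fun _ : Fin t => P).prod P), q ∈ D' ↔ q ∈ D :=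
    eventuallyEq_set.1 hDD'
  have hfst : ∀ᵐ ω ∂(Measure.infinitePi fun _ : ℕ => P),
      ∀ᵐ z ∂P, ((fun i : Fin t => ω i), z) ∈ D' ↔ ((fun i : Fin t => ω i), z) ∈ D :=
    (measurePreserving_split_infinitePi P t).quasiMeasurePreserving.ae
      (Measure.quasiMeasurePreserving_fst.ae (Measure.ae_ae_of_ae_prod hmem))
  have hlater : ∀ᵐ ω ∂(Measure.infinitePi fun _ : ℕ => P), ∀ n,
      ((fun i : Fin t => ω i), ω (t + n)) ∈ D' ↔ ((fun i : Fin t => ω i), ω (t + n)) ∈ D :=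
    ae_all_iff.2 fun n =>
      (measurePreserving_sample_eval_infinitePi P t n).quasiMeasurePreserving.ae hmem
  have hhit : ∀ᵐ q ∂((Measure.pi fun _ : Fin t => P).prod (Measure.infinitePi fun _ : ℕ => P)),
      0 < P {z | (q.1, z) ∈ D'} → ∃ n, (q.1, q.2 n) ∈ D' := by
    have h1 : MeasurableSet {q : (Fin t → Z) × (ℕ → Z) | 0 < P {z | (q.1, z) ∈ D'}} :=
      measurableSet_lt measurable_const
        ((measurable_measure_prodMk_left hD').comp measurable_fst)
    have h2 : MeasurableSet {q : (Fin t → Z) × (ℕ → Z) | ∃ n, (q.1, q.2 n) ∈ D'} := by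
      rw [Set.ofPred_exists]
      refine MeasurableSet.iUnion fun n => ?_
      have : Measurable fun q : (Fin t → Z) × (ℕ → Z) => (q.1, q.2 n) := by fun_prop
      exact this hD'
    rw [Measure.ae_prod_iff_ae_ae (h1.imp h2)]
    refine ae_of_all _ fun s => ?_
    by_cases hs : 0 < P {z | (s, z) ∈ D'}
    · filter_upwards [ae_exists_mem_of_measure_pos P
        (A := {z | (s, z) ∈ D'}) (measurable_prodMk_left hD') hs] with τ hτ _ using hτ
    · exact ae_of_all _ fun τ h => absurd h hs
  filter_upwards [hfst, hlater,
    (measurePreserving_split_infinitePi P t).quasiMeasurePreserving.ae hhit]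
    with ω h1 h2 h3 hpos
  have hsec : P {z | ((fun i : Fin t => ω i), z) ∈ D'} =
      P {z | ((fun i : Fin t => ω i), z) ∈ D} := measure_congr (eventuallyEq_set.2 h1)
  rw [← hsec] at hpos
  obtain ⟨n, hn⟩ := h3 hpos
  exact ⟨n, (h2 n).1 hn⟩

/-- The set of samples at which the section of a null-measurable set has positive measure is
null-measurable. -/
lemma nullMeasurableSet_measure_section_pos {S : Type*} [MeasurableSpace S] {μ : Measure S}
    [SFinite μ] {D : Set (S × Z)} (hD : NullMeasurableSet D (μ.prod P)) :
    NullMeasurableSet {s | 0 < P {z | (s, z) ∈ D}} μ := by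
  obtain ⟨D', -, hD', hDD'⟩ := hD.exists_measurable_superset_ae_eq
  have h1 : MeasurableSet {s : S | 0 < P {z | (s, z) ∈ D'}} :=
    measurableSet_lt measurable_const (measurable_measure_prodMk_left hD')
  refine h1.nullMeasurableSet.congr (eventuallyEq_set.2 ?_)
  filter_upwards [Measure.ae_ae_of_ae_prod (eventuallyEq_set.1 hDD')] with s hs
  have hsec : P {z | (s, z) ∈ D'} = P {z | (s, z) ∈ D} :=
    measure_congr (eventuallyEq_set.2 hs)
  change 0 < P {z | (s, z) ∈ D'} ↔ 0 < P {z | (s, z) ∈ D}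
  rw [hsec]

end ProductMeasure

/-- Under a realizable distribution, an i.i.d. sequence is almost surely consistent. -/
lemma ae_consistentWith_of_realizable [MeasurableSpace 𝒳] {ℋ : Set (𝒳 → Bool)}
    {P : Measure (𝒳 × Bool)} [IsProbabilityMeasure P] (hreal : Realizable ℋ P) :
    ∀ᵐ ω ∂(Measure.infinitePi fun _ : ℕ => P),
      ConsistentWith ℋ (fun t => (ω t).1) (fun t => (ω t).2) := by
  refine ae_all_iff.2 fun t => ?_
  rw [ae_iff]
  have hbound : ∀ h ∈ ℋ, Measure.infinitePi (fun _ : ℕ => P)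
      {ω | ¬ ∃ h ∈ ℋ, ∀ s ≤ t, h (ω s).1 = (ω s).2} ≤ (t + 1 : ℕ) * errP P h := by
    intro h hh
    calc _ ≤ Measure.infinitePi (fun _ : ℕ => P)
          (⋃ s ∈ Finset.range (t + 1), Function.eval s ⁻¹' {p | h p.1 ≠ p.2}) := by
          refine measure_mono fun ω hω => ?_
          simp only [Set.mem_ofPred_eq, not_exists, not_and, not_forall] at hω
          obtain ⟨s, hs, hne⟩ := hω h hh
          simp only [Set.mem_iUnion]
          exact ⟨s, Finset.mem_range.2 (Nat.lt_succ_of_le hs), hne⟩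
      _ ≤ ∑ s ∈ Finset.range (t + 1), Measure.infinitePi (fun _ : ℕ => P)
          (Function.eval s ⁻¹' {p | h p.1 ≠ p.2}) := measure_biUnion_finset_le _ _
      _ ≤ ∑ s ∈ Finset.range (t + 1), errP P h :=
          Finset.sum_le_sum fun s _ =>
            (measurePreserving_eval_infinitePi (fun _ : ℕ => P) s).measure_preimage_le _
      _ = (t + 1 : ℕ) * errP P h := by simp
  refine le_antisymm ?_ zero_le
  have hne : ((t + 1 : ℕ) : ℝ≥0∞) ≠ 0 := by exact_mod_cast t.succ_ne_zero
  have hdiv : Measure.infinitePi (fun _ : ℕ => P)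
      {ω | ¬ ∃ h ∈ ℋ, ∀ s ≤ t, h (ω s).1 = (ω s).2} / (t + 1 : ℕ) ≤ 0 := by
    rw [← (hreal : (⨅ h ∈ ℋ, errP P h) = 0)]
    exact le_iInf₂ fun h hh => ENNReal.div_le_of_le_mul' (hbound h hh)
  have := (ENNReal.div_le_iff hne (ENNReal.natCast_ne_top _)).1 hdiv
  simpa using this

/-- The set of samples and test points on which a universally measurable predictor errs is
null-measurable. -/
lemma nullMeasurableSet_mistake [MeasurableSpace 𝒳] {S : Type*} [MeasurableSpace S]
    {f : S → 𝒳 → Bool} (hf : UniversallyMeasurable fun q : S × 𝒳 => f q.1 q.2)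
    (μ : Measure S) [IsProbabilityMeasure μ] (P : Measure (𝒳 × Bool)) [IsProbabilityMeasure P] :
    NullMeasurableSet {q : S × (𝒳 × Bool) | f q.1 q.2.1 ≠ q.2.2} (μ.prod P) := by
  have : IsProbabilityMeasure (P.map Prod.fst) :=
    Measure.isProbabilityMeasure_map measurable_fst.aemeasurable
  have hmp : MeasurePreserving (Prod.map id Prod.fst : S × (𝒳 × Bool) → S × 𝒳)
      (μ.prod P) (μ.prod (P.map Prod.fst)) :=
    (MeasurePreserving.id μ).prod (measurable_fst.measurePreserving P)
  have hpre : ∀ b : Bool,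
      NullMeasurableSet {q : S × (𝒳 × Bool) | f q.1 q.2.1 = b} (μ.prod P) := fun b =>
    NullMeasurableSet.preimage (hf (μ.prod (P.map Prod.fst)) inferInstance
      (measurableSet_singleton b)) hmp.quasiMeasurePreserving
  have hlab : ∀ b : Bool,
      NullMeasurableSet {q : S × (𝒳 × Bool) | q.2.2 = b} (μ.prod P) := fun b =>
    ((measurable_snd.comp measurable_snd) (measurableSet_singleton b)).nullMeasurableSet
  convert ((hpre true).inter (hlab false)).union ((hpre false).inter (hlab true)) using 1
  ext q
  simp only [Set.mem_ofPred_eq, Set.mem_union, Set.mem_inter_iff]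
  cases f q.1 q.2.1 <;> cases q.2.2 <;> simp

/-- If a learner that changes only upon mistakes makes no mistake from time `t` on, then its
predictor stays the one learned at time `t`. -/
lemma predictor_eq_of_no_mistake {Yhat : ∀ t : ℕ, (Fin t → 𝒳 × Bool) → 𝒳 → Bool}
    (hstable : ∀ (t : ℕ) (s : Fin t → 𝒳 × Bool) (x : 𝒳) (y : Bool),
      Yhat t s x = y → ∀ z : 𝒳, Yhat (t + 1) (Fin.snoc s (x, y)) z = Yhat t s z)
    {ω : ℕ → 𝒳 × Bool} {t : ℕ}
    (hω : ∀ n, Yhat (t + n) (fun i => ω i) (ω (t + n)).1 = (ω (t + n)).2) (n : ℕ) :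
    Yhat (t + n) (fun i => ω i) = Yhat t (fun i => ω i) := by
  induction n with
  | zero => rfl
  | succ n ih =>
    rw [← ih]
    have hsnoc : (fun i : Fin (t + n + 1) => ω i) =
        Fin.snoc (α := fun _ => 𝒳 × Bool) (fun i : Fin (t + n) => ω i)
          ((ω (t + n)).1, (ω (t + n)).2) := by
      funext i
      refine Fin.lastCases ?_ (fun j => ?_) i
      · simp
      · simp
    funext z
    change Yhat (t + n + 1) (fun i : Fin (t + n + 1) => ω i) z = _
    rw [hsnoc]
    exact hstable _ _ _ _ (hω n) z

/-- **Lemma 4.3.** Let `Ŷ_t` be universally measurable online predictors that (i) make finitely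
many mistakes on every sequence consistent with `ℋ` and (ii) change only when a mistake is made.
Then for every realizable `P`, with i.i.d. samples from `P` and `ŷ_t` the predictor trained on
the first `t` samples, `P^{⊗t}{er_P(ŷ_t) > 0} → 0` as `t → ∞`. -/
theorem eventually_correct_in_probability
    (𝒳 : Type*) [TopologicalSpace 𝒳] [PolishSpace 𝒳] [MeasurableSpace 𝒳] [BorelSpace 𝒳]
    (ℋ : Set (𝒳 → Bool))
    (Yhat : ∀ t : ℕ, (Fin t → 𝒳 × Bool) → 𝒳 → Bool)
    (hmeas : ∀ t : ℕ, UniversallyMeasurable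
      fun q : (Fin t → 𝒳 × Bool) × 𝒳 => Yhat t q.1 q.2)
    (hfin : ∀ (x : ℕ → 𝒳) (y : ℕ → Bool), ConsistentWith ℋ x y →
      {t : ℕ | Yhat t (fun i : Fin t => (x i, y i)) (x t) ≠ y t}.Finite)
    (hstable : ∀ (t : ℕ) (s : Fin t → 𝒳 × Bool) (x : 𝒳) (y : Bool),
      Yhat t s x = y → ∀ z : 𝒳, Yhat (t + 1) (Fin.snoc s (x, y)) z = Yhat t s z)
    (P : MeasureTheory.Measure (𝒳 × Bool)) (hprob : MeasureTheory.IsProbabilityMeasure P)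
    (hreal : Realizable ℋ P) :
    Filter.Tendsto
      (fun t : ℕ => (MeasureTheory.Measure.pi fun _ : Fin t => P)
        {s : Fin t → 𝒳 × Bool | 0 < errP P (Yhat t s)})
      Filter.atTop (nhds 0) := by
  have hD := fun t => nullMeasurableSet_mistake (hmeas t) (Measure.pi fun _ : Fin t => P) P
  set μ := Measure.infinitePi fun _ : ℕ => P
  set M : ℕ → Set (ℕ → 𝒳 × Bool) :=
    fun t => {ω | Yhat t (fun i : Fin t => ω i) (ω t).1 ≠ (ω t).2}
  set F : ℕ → Set (ℕ → 𝒳 × Bool) := fun t => ⋃ n, M (t + n)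
  have hMmeas : ∀ t, NullMeasurableSet (M t) μ := fun t =>
    (hD t).preimage (measurePreserving_sample_eval_infinitePi P t 0).quasiMeasurePreserving
  have hFanti : Antitone F := by
    intro s t hst ω hω
    obtain ⟨n, hn⟩ := Set.mem_iUnion.1 hω
    refine Set.mem_iUnion.2 ⟨t - s + n, ?_⟩
    rwa [← add_assoc, Nat.add_sub_cancel' hst]
  have hFnull : μ (⋂ t, F t) = 0 := by
    refine measure_mono_null ?_ (ae_iff.1 (ae_consistentWith_of_realizable hreal))
    intro ω hω hcons
    obtain ⟨b, hb⟩ := (hfin _ _ hcons).bddAbove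
    obtain ⟨n, hn⟩ := Set.mem_iUnion.1 (Set.mem_iInter.1 hω (b + 1))
    have : b + 1 + n ≤ b := hb hn
    omega
  have hFtendsto : Tendsto (μ ∘ F) atTop (𝓝 0) := by
    rw [← hFnull]
    exact tendsto_measure_iInter_atTop
      (fun t => NullMeasurableSet.iUnion fun n => hMmeas (t + n)) hFanti
      ⟨0, measure_ne_top _ _⟩
  refine tendsto_of_tendsto_of_tendsto_of_le_of_le tendsto_const_nhds hFtendsto
    (fun _ => zero_le) fun t => ?_
  have hsample : MeasurePreserving (fun (ω : ℕ → 𝒳 × Bool) (i : Fin t) => ω i) μ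
      (Measure.pi fun _ : Fin t => P) :=
    measurePreserving_fst.comp (measurePreserving_split_infinitePi P t)
  calc _ = μ ((fun (ω : ℕ → 𝒳 × Bool) (i : Fin t) => ω i) ⁻¹' {s | 0 < errP P (Yhat t s)}) :=
        (hsample.measure_preimage (nullMeasurableSet_measure_section_pos P (hD t))).symm
    _ ≤ μ (F t) := by
        refine measure_mono_ae ?_
        filter_upwards [ae_exists_mem_section P (hD t)] with ω hω hpos
        by_contra hnot
        have hcorrect : ∀ n, Yhat (t + n) (fun i => ω i) (ω (t + n)).1 = (ω (t + n)).2 :=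
          fun n => by_contra fun hne => hnot (Set.mem_iUnion.2 ⟨n, hne⟩)
        obtain ⟨n, hn⟩ := hω hpos
        refine hn ?_
        rw [← hcorrect n, predictor_eq_of_no_mistake hstable hcorrect n]
end

section
/- Corollary 4.5 (exponential upper bound): Let 𝒳 be a Polish space and ℋ a measurable concept class. If ℋ does not have an infinite Littlestone tree, then there exists a learning algorithm ĥ_n such that for every realizable distribution P there exist C, c > 0 with P{er_P(ĥ_n) > 0} ≤ C·e^{-c·n} for all n; in particular E[er_P(ĥ_n)] ≤ C·e^{-c·n} for all n, so ℋ is learnable at rate e^{-n}. -/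
open scoped ENNReal

variable {𝒳 : Type*}

section Auxiliary

open MeasureTheory Set Filter Topology
open scoped Ordinal

theorem isCompact_box (k : ℕ → ℕ) : IsCompact {z : ℕ → ℕ | ∀ i, z i ≤ k i} := by
  have h := isCompact_univ_pi (X := fun _ : ℕ => ℕ) (s := fun i => Iic (k i))
    fun i => (finite_Iic (k i)).isCompact
  convert h using 1
  ext z
  simp [Pi.le_def]

theorem exists_initial_box_subset (k : ℕ → ℕ) {O : Set (ℕ → ℕ)} (hO : IsOpen O)
    (hK : {z : ℕ → ℕ | ∀ i, z i ≤ k i} ⊆ O) :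
    ∃ n, {z : ℕ → ℕ | ∀ i < n, z i ≤ k i} ⊆ O := by
  have hcomp := isCompact_box k
  by_contra! hcon
  choose z hz hzO using fun n => not_subset.1 (hcon n)
  obtain ⟨w, hw, φ, hφ, hlim⟩ :=
    hcomp.tendsto_subseq (x := fun n i => min (z n i) (k i)) fun n i => min_le_right _ _
  have hlim' : Tendsto (z ∘ φ) atTop (𝓝 w) := by
    rw [tendsto_pi_nhds] at hlim ⊢
    intro i
    refine (hlim i).congr' ?_
    filter_upwards [eventually_gt_atTop i] with n hn
    exact min_eq_left (hz _ i (hn.trans_le (hφ.id_le n)))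
  obtain ⟨n, hn⟩ := (hlim'.eventually (hO.mem_nhds (hK hw))).exists
  exact hzO _ hn

theorem exists_isCompact_subset_range_lt_measure {α : Type*} [TopologicalSpace α] [T2Space α]
    [RegularSpace α] [MeasurableSpace α] [OpensMeasurableSpace α] (μ : Measure α)
    [IsFiniteMeasure μ] {g : (ℕ → ℕ) → α} (hg : Continuous g) {c : ENNReal}
    (hc : c < μ (range g)) : ∃ K ⊆ range g, IsCompact K ∧ c ≤ μ K := by
  have step : ∀ (n : ℕ) (S : {S : Set (ℕ → ℕ) // c < μ (g '' S)}),
      ∃ m : ℕ, c < μ (g '' (S ∩ {z | z n ≤ m})) := by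
    rintro n ⟨S, hS⟩
    have hU : g '' S = ⋃ m : ℕ, g '' (S ∩ {z | z n ≤ m}) := by
      rw [← image_iUnion, ← inter_iUnion]
      congr 1
      refine (inter_eq_left.2 fun z _ => mem_iUnion.2 ⟨z n, le_refl (z n)⟩).symm
    have hmono : Monotone fun m : ℕ => g '' (S ∩ {z | z n ≤ m}) := fun a b hab =>
      image_mono (inter_subset_inter_right _ fun z (hz : z n ≤ a) => hz.trans hab)
    rw [hU, hmono.measure_iUnion] at hS
    exact lt_iSup_iff.1 hS
  choose m hm using step
  let S : ℕ → {S : Set (ℕ → ℕ) // c < μ (g '' S)} := fun n =>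
    Nat.rec ⟨univ, by rwa [image_univ]⟩ (fun n S => ⟨S ∩ {z | z n ≤ m n S}, hm n S⟩) n
  set k : ℕ → ℕ := fun n => m n (S n)
  have hS : ∀ n, (S n).1 = {z | ∀ i < n, z i ≤ k i} := by
    intro n
    induction n with
    | zero => ext z; simp [S]
    | succ n ih =>
      have : (S (n + 1)).1 = (S n).1 ∩ {z | z n ≤ k n} := rfl
      rw [this, ih]
      ext z
      exact Nat.forall_lt_succ_right.symm
  have hcomp := isCompact_box k
  have hK := hcomp.image hg
  refine ⟨_, image_subset_range g _, hK, ?_⟩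
  have hsub : ⋂ n, closure (g '' (S n).1) ⊆ g '' {z : ℕ → ℕ | ∀ i, z i ≤ k i} := by
    intro y hy
    by_contra hyK
    obtain ⟨U, hU, hKU, hyU⟩ : ∃ U, IsOpen U ∧ g '' {z : ℕ → ℕ | ∀ i, z i ≤ k i} ⊆ U ∧
        y ∉ closure U := by
      obtain ⟨U, V, hU, hV, hKU, hyV, hd⟩ :=
        hK.separation_of_notMem hyK
      exact ⟨U, hU, hKU, fun hcl =>
        (hd.symm.closure_right hV).le_bot ⟨hyV, hcl⟩⟩
    obtain ⟨n, hn⟩ := exists_initial_box_subset k (hU.preimage hg) (image_subset_iff.1 hKU)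
    refine hyU (closure_mono ?_ (mem_iInter.1 hy n))
    rw [hS n]
    exact image_subset_iff.2 hn
  refine le_trans ?_ (measure_mono hsub)
  have hanti : Antitone fun n => closure (g '' (S n).1) := by
    refine antitone_nat_of_succ_le fun n => closure_mono (image_mono ?_)
    exact inter_subset_left
  rw [hanti.measure_iInter (fun n => isClosed_closure.measurableSet.nullMeasurableSet)
    ⟨0, measure_ne_top _ _⟩]
  exact le_iInf fun n => (S n).2.le.trans (measure_mono subset_closure)

theorem analyticSet_nullMeasurableSet {α : Type*} [TopologicalSpace α] [T2Space α]
    [RegularSpace α] [MeasurableSpace α] [OpensMeasurableSpace α] {s : Set α}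
    (hs : AnalyticSet s) (μ : Measure α) [IsFiniteMeasure μ] : NullMeasurableSet s μ := by
  rw [AnalyticSet] at hs
  rcases hs with rfl | ⟨g, hg, rfl⟩
  · exact nullMeasurableSet_empty
  have key : ∀ c : Iio (μ (range g)), ∃ K ⊆ range g, IsCompact K ∧ c ≤ μ K :=
    fun c => exists_isCompact_subset_range_lt_measure μ hg c.2
  choose K hsub hcomp hle using key
  rcases eq_or_ne (μ (range g)) 0 with h0 | h0
  · exact NullMeasurableSet.of_null h0
  obtain ⟨u, -, hu, hlim⟩ := exists_seq_strictMono_tendsto' (pos_iff_ne_zero.2 h0)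
  have hM : MeasurableSet (⋃ n, K ⟨u n, (hu n).2⟩) :=
    .iUnion fun n => (hcomp _).measurableSet
  have hsubM : ⋃ n, K ⟨u n, (hu n).2⟩ ⊆ range g := iUnion_subset fun n => hsub _
  refine hM.nullMeasurableSet.congr
    (ae_eq_of_subset_of_measure_ge hsubM ?_ hM.nullMeasurableSet (measure_ne_top _ _))
  exact le_of_tendsto' hlim fun n => (hle ⟨u n, (hu n).2⟩).trans
    (measure_mono (subset_iUnion (fun n => K ⟨u n, (hu n).2⟩) n))

/-- The version space `V ⊆ Θ` has ordinal Littlestone dimension at least `α`. -/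
def LittlestoneDimGE {Θ : Type*} (f : Θ → 𝒳 → Bool) (α : Ordinal.{0}) (V : Set Θ) : Prop :=
  V.Nonempty ∧ ∀ β, β < α → ∃ x, ∀ b, LittlestoneDimGE f β (V ∩ {θ | f θ x = b})
termination_by α

/-- The parameters consistent with a labelled sample. -/
def versionSpace {Θ : Type*} (f : Θ → 𝒳 → Bool) {n : ℕ} (s : Fin n → 𝒳 × Bool) : Set Θ :=
  {θ | ∀ i, f θ (s i).1 = (s i).2}

section Dimension

variable {Θ : Type*} {f : Θ → 𝒳 → Bool}

theorem littlestoneDimGE_iff {α : Ordinal.{0}} {V : Set Θ} : LittlestoneDimGE f α V ↔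
    V.Nonempty ∧ ∀ β < α, ∃ x, ∀ b, LittlestoneDimGE f β (V ∩ {θ | f θ x = b}) := by
  rw [LittlestoneDimGE]

theorem LittlestoneDimGE.nonempty {α : Ordinal.{0}} {V : Set Θ} (h : LittlestoneDimGE f α V) :
    V.Nonempty := (littlestoneDimGE_iff.1 h).1

theorem littlestoneDimGE_zero {V : Set Θ} : LittlestoneDimGE f 0 V ↔ V.Nonempty := by
  simp [littlestoneDimGE_iff (α := 0)]

theorem LittlestoneDimGE.anti {α β : Ordinal.{0}} {V : Set Θ} (h : LittlestoneDimGE f α V)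
    (hβ : β ≤ α) : LittlestoneDimGE f β V := by
  rw [littlestoneDimGE_iff] at h ⊢
  exact ⟨h.1, fun γ hγ => h.2 γ (hγ.trans_le hβ)⟩

theorem LittlestoneDimGE.mono {α : Ordinal.{0}} {V W : Set Θ} (h : LittlestoneDimGE f α V)
    (hVW : V ⊆ W) : LittlestoneDimGE f α W := by
  induction α using WellFoundedLT.induction generalizing V W with
  | ind α ih =>
    rw [littlestoneDimGE_iff] at h ⊢
    refine ⟨h.1.mono hVW, fun β hβ => ?_⟩
    obtain ⟨x, hx⟩ := h.2 β hβ
    exact ⟨x, fun b => ih β hβ (hx b) (inter_subset_inter_left _ hVW)⟩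

theorem versionSpace_cons {n : ℕ} (p : 𝒳 × Bool) (s : Fin n → 𝒳 × Bool) :
    versionSpace f (Fin.cons p s : Fin (n + 1) → 𝒳 × Bool)
      = versionSpace f s ∩ {θ | f θ p.1 = p.2} := by
  ext θ
  simp [versionSpace, Fin.forall_fin_succ, and_comm]

theorem countable_Iio_of_lt_omega_one {α : Ordinal.{0}} (hα : α < ω₁) : (Iio α).Countable := by
  rw [← Cardinal.le_aleph0_iff_set_countable, Cardinal.mk_Iio_ordinal,
    ← Cardinal.lift_aleph0.{1, 0}, Cardinal.lift_le, ← Order.lt_succ_iff, Cardinal.succ_aleph0]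
  exact Cardinal.lt_ord.1 (by rwa [Cardinal.ord_aleph])

end Dimension

section Measurability

variable {Θ : Type*} {f : Θ → 𝒳 → Bool} [TopologicalSpace Θ] [PolishSpace Θ] [MeasurableSpace Θ]
  [BorelSpace Θ] [TopologicalSpace 𝒳] [PolishSpace 𝒳] [MeasurableSpace 𝒳] [BorelSpace 𝒳]

theorem analyticSet_littlestoneDimGE (hf : Measurable (Function.uncurry f)) {α : Ordinal.{0}}
    (hα : α < ω₁) (n : ℕ) :
    AnalyticSet {s : Fin n → 𝒳 × Bool | LittlestoneDimGE f α (versionSpace f s)} := by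
  induction α using WellFoundedLT.induction generalizing n with
  | ind α ih =>
    have hne : AnalyticSet {s : Fin n → 𝒳 × Bool | (versionSpace f s).Nonempty} := by
      have hm : MeasurableSet {q : Θ × (Fin n → 𝒳 × Bool) | q.1 ∈ versionSpace f q.2} := by
        have : {q : Θ × (Fin n → 𝒳 × Bool) | q.1 ∈ versionSpace f q.2} =
            ⋂ i, {q | f q.1 (q.2 i).1 = (q.2 i).2} := by ext; simp [versionSpace]
        rw [this]
        refine .iInter fun i => measurableSet_eq_fun ?_ (by fun_prop)
        have hg : Measurable fun q : Θ × (Fin n → 𝒳 × Bool) => (q.1, (q.2 i).1) := by fun_prop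
        exact hf.comp hg
      convert! hm.analyticSet.image_of_continuous continuous_snd
      ext s
      simp [Set.Nonempty]
    have hstep : ∀ β < α, AnalyticSet {s : Fin n → 𝒳 × Bool |
        ∃ x, ∀ b, LittlestoneDimGE f β (versionSpace f s ∩ {θ | f θ x = b})} := by
      intro β hβ
      have hB : AnalyticSet (⋂ b : Bool, (fun q : (Fin n → 𝒳 × Bool) × 𝒳 =>
          (Fin.cons (q.2, b) q.1 : Fin (n + 1) → 𝒳 × Bool)) ⁻¹'
          {s | LittlestoneDimGE f β (versionSpace f s)}) := by
        refine .iInter fun b => (ih β hβ (hβ.trans hα) (n + 1)).preimage ?_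
        fun_prop
      convert! hB.image_of_continuous continuous_fst
      ext s
      simp [versionSpace_cons]
    have : {s : Fin n → 𝒳 × Bool | LittlestoneDimGE f α (versionSpace f s)} =
        ⋂ o : Option (Iio α), o.elim {s | (versionSpace f s).Nonempty} fun β =>
          {s | ∃ x, ∀ b, LittlestoneDimGE f β (versionSpace f s ∩ {θ | f θ x = b})} := by
      ext s
      rw [mem_ofPred_eq, littlestoneDimGE_iff]
      simp [iInter_option]
    rw [this]
    have := (countable_Iio_of_lt_omega_one hα).to_subtype
    refine .iInter fun o => ?_
    cases o with
    | none => exact hne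
    | some β => exact hstep β β.2

end Measurability

section Tree

variable {Θ : Type*} {f : Θ → 𝒳 → Bool}

/-- The parameters consistent with the first `n` labels of the branch `y` of the tree `x`. -/
def branchVersionSpace (f : Θ → 𝒳 → Bool) (x : List Bool → 𝒳) (y : ℕ → Bool) (n : ℕ) : Set Θ :=
  {θ | ∀ k < n, f θ (x (List.ofFn fun i : Fin k => y i)) = y k}

/-- All branches of length `n` of the tree `x` have version spaces of dimension at least `α`. -/
def IsLittlestoneTree (f : Θ → 𝒳 → Bool) (α : Ordinal.{0}) (n : ℕ) (x : List Bool → 𝒳) : Prop :=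
  ∀ y : ℕ → Bool, LittlestoneDimGE f α (branchVersionSpace f x y n)

theorem branchVersionSpace_congr_tree {x x' : List Bool → 𝒳} {n : ℕ}
    (h : ∀ u : List Bool, u.length < n → x u = x' u) (y : ℕ → Bool) :
    branchVersionSpace f x y n = branchVersionSpace f x' y n := by
  ext θ
  refine forall₂_congr fun k hk => ?_
  rw [h _ (by simpa using hk)]

theorem branchVersionSpace_congr_branch (x : List Bool → 𝒳) {y y' : ℕ → Bool} {n : ℕ}
    (h : ∀ i < n, y i = y' i) : branchVersionSpace f x y n = branchVersionSpace f x y' n := by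
  ext θ
  refine forall₂_congr fun k hk => ?_
  rw [h k hk]
  have : (fun i : Fin k => y i) = fun i : Fin k => y' i := funext fun i => h i (i.2.trans hk)
  rw [this]

theorem branchVersionSpace_succ (x : List Bool → 𝒳) (y : ℕ → Bool) (n : ℕ) :
    branchVersionSpace f x y (n + 1) =
      branchVersionSpace f x y n ∩ {θ | f θ (x (List.ofFn fun i : Fin n => y i)) = y n} := by
  ext θ
  exact Nat.forall_lt_succ_right

theorem getD_ofFn (y : ℕ → Bool) {n i : ℕ} (hi : i < n) :
    (List.ofFn fun i : Fin n => y i).getD i false = y i := by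
  simp [List.getD_eq_getElem?_getD, hi]

theorem IsLittlestoneTree.anti {α β : Ordinal.{0}} {n : ℕ} {x : List Bool → 𝒳}
    (h : IsLittlestoneTree f α n x) (hβ : β ≤ α) : IsLittlestoneTree f β n x :=
  fun y => (h y).anti hβ

theorem IsLittlestoneTree.exists_extension {α β : Ordinal.{0}} {n : ℕ} {x : List Bool → 𝒳}
    (h : IsLittlestoneTree f α n x) (hβ : β < α) :
    ∃ x' : List Bool → 𝒳, (∀ u, u.length < n → x' u = x u) ∧ IsLittlestoneTree f β (n + 1) x' := by
  have key : ∀ u : List Bool, ∃ a, ∀ b, LittlestoneDimGE f β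
      (branchVersionSpace f x (fun i => u.getD i false) n ∩ {θ | f θ a = b}) := fun u =>
    (littlestoneDimGE_iff.1 (h fun i => u.getD i false)).2 β hβ
  choose a ha using key
  have hagree : ∀ u : List Bool, u.length < n → (if u.length < n then x u else a u) = x u :=
    fun u hu => if_pos hu
  refine ⟨fun u => if u.length < n then x u else a u, hagree, fun y => ?_⟩
  rw [branchVersionSpace_succ, branchVersionSpace_congr_tree hagree]
  have := ha (List.ofFn fun i : Fin n => y i) (y n)
  rw [branchVersionSpace_congr_branch x fun i hi => getD_ofFn y hi] at this
  simpa using this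

theorem exists_isLittlestoneTree (h : ∀ α < ω₁, LittlestoneDimGE f α univ) (n : ℕ) :
    ∀ α < ω₁, ∃ x, IsLittlestoneTree f α n x := by
  induction n with
  | zero =>
    intro α hα
    obtain ⟨x, -⟩ := (littlestoneDimGE_iff.1 (h 1 (Ordinal.one_lt_omega0.trans Ordinal.omega0_lt_omega_one))).2 0 zero_lt_one
    exact ⟨fun _ => x, fun y => by simpa [branchVersionSpace] using h α hα⟩
  | succ n ih =>
    intro α hα
    obtain ⟨x, hx⟩ := ih _ ((Cardinal.isSuccLimit_omega 1).succ_lt hα)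
    obtain ⟨x', -, hx'⟩ := hx.exists_extension (Order.lt_succ α)
    exact ⟨x', hx'⟩

theorem analyticSet_isLittlestoneTree_zero [TopologicalSpace Θ] [PolishSpace Θ]
    [MeasurableSpace Θ] [BorelSpace Θ] [TopologicalSpace 𝒳] [PolishSpace 𝒳] [MeasurableSpace 𝒳]
    [BorelSpace 𝒳] (hf : Measurable (Function.uncurry f)) (n : ℕ) :
    AnalyticSet {x | IsLittlestoneTree f 0 n x} := by
  have heq : {x | IsLittlestoneTree f 0 n x} = ⋂ u : List Bool,
      {x | (branchVersionSpace f x (fun i => u.getD i false) n).Nonempty} := by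
    ext x
    simp only [IsLittlestoneTree, littlestoneDimGE_zero, mem_ofPred_eq, mem_iInter]
    refine ⟨fun h u => h _, fun h y => ?_⟩
    rw [← branchVersionSpace_congr_branch x fun i (hi : i < n) => getD_ofFn y hi]
    exact h _
  rw [heq]
  refine .iInter fun u => ?_
  set y : ℕ → Bool := fun i => u.getD i false
  have hm : MeasurableSet {q : Θ × (List Bool → 𝒳) | q.1 ∈ branchVersionSpace f q.2 y n} := by
    have : {q : Θ × (List Bool → 𝒳) | q.1 ∈ branchVersionSpace f q.2 y n} =
        ⋂ k, ⋂ _ : k < n, {q | f q.1 (q.2 (List.ofFn fun i : Fin k => y i)) = y k} := by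
      ext; simp [branchVersionSpace]
    rw [this]
    refine .iInter fun k => .iInter fun _ => measurableSet_eq_fun ?_ measurable_const
    have hg : Measurable fun q : Θ × (List Bool → 𝒳) =>
      (q.1, q.2 (List.ofFn fun i : Fin k => y i)) := by fun_prop
    exact hf.comp hg
  convert! hm.analyticSet.image_of_continuous continuous_snd
  ext s
  simp [Set.Nonempty]

/-- A tree of dimension at least `α` and depth `n` whose consistency is witnessed by codes `z i`
(through the parametrizations `g i`) whose first digits are those of `p`. -/
def HasCodedTree (f : Θ → 𝒳 → Bool) (g : ℕ → (ℕ → ℕ) → List Bool → 𝒳) (n : ℕ) (p : ℕ → ℕ → ℕ)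
    (α : Ordinal.{0}) : Prop :=
  ∃ x, IsLittlestoneTree f α n x ∧ ∃ z : ℕ → ℕ → ℕ,
    (∀ i ≤ n, ∀ u : List Bool, u.length < i → g i (z i) u = x u) ∧
      ∀ i < n, ∀ j < n, z i j = p i j

theorem HasCodedTree.exists_extension {g : ℕ → (ℕ → ℕ) → List Bool → 𝒳}
    (hg : ∀ n, range (g n) = {x | IsLittlestoneTree f 0 n x}) {n : ℕ} {p : ℕ → ℕ → ℕ}
    (h : ∀ α < ω₁, HasCodedTree f g n p α) :
    ∃ p', (∀ i < n, ∀ j < n, p' i j = p i j) ∧ ∀ α < ω₁, HasCodedTree f g (n + 1) p' α := by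
  by_contra! hcon
  let e : (Fin (n + 1) → Fin (n + 1) → ℕ) → ℕ → ℕ → ℕ := fun q i j =>
    q (Fin.ofNat (n + 1) i) (Fin.ofNat (n + 1) j)
  have hbad : ∀ q, ∃ α < ω₁, (∀ i < n, ∀ j < n, e q i j = p i j) →
      ¬ HasCodedTree f g (n + 1) (e q) α := by
    intro q
    by_cases hq : ∀ i < n, ∀ j < n, e q i j = p i j
    · obtain ⟨α, hα, hn⟩ := hcon _ hq
      exact ⟨α, hα, fun _ => hn⟩
    · exact ⟨0, Ordinal.omega_pos 1, fun h => absurd h hq⟩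
  choose α hα hnot using hbad
  have hsup : ⨆ q, α q < ω₁ := Ordinal.iSup_lt_omega_one hα
  obtain ⟨x, hx, z, hzx, hzp⟩ := h _ ((Cardinal.isSuccLimit_omega 1).succ_lt hsup)
  obtain ⟨x', hxx', hx'⟩ := hx.exists_extension (Order.lt_succ _)
  obtain ⟨w, hw⟩ : x' ∈ range (g (n + 1)) := by
    rw [hg]
    exact hx'.anti zero_le
  set z' := Function.update z (n + 1) w
  have hz' : ∀ i ≤ n, z' i = z i := fun i hi => Function.update_of_ne (by omega) _ _
  have hez : ∀ i < n + 1, ∀ j < n + 1, z' i j = e (fun i j => z' i j) i j := by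
    intro i hi j hj
    simp [e, Nat.mod_eq_of_lt hi, Nat.mod_eq_of_lt hj]
  refine hnot (fun i j => z' i j) (fun i hi j hj => ?_) ⟨x', hx'.anti (Ordinal.le_iSup α _), z',
    fun i hi u hu => ?_, hez⟩
  · rw [← hez i (by omega) j (by omega), hz' i hi.le, hzp i hi j hj]
  · rcases Nat.le_succ_iff.1 hi with hi | rfl
    · rw [hz' i hi, hzx i hi u hu, hxx' u (hu.trans_le hi)]
    · simp [z', hw]

theorem hasInfiniteLittlestoneTree_of_forall_littlestoneDimGE [TopologicalSpace Θ]
    [PolishSpace Θ] [MeasurableSpace Θ] [BorelSpace Θ] [TopologicalSpace 𝒳] [PolishSpace 𝒳]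
    [MeasurableSpace 𝒳] [BorelSpace 𝒳] (hf : Measurable (Function.uncurry f))
    (h : ∀ α < ω₁, LittlestoneDimGE f α univ) : HasInfiniteLittlestoneTree (range f) := by
  have hpar : ∀ n, ∃ g : (ℕ → ℕ) → List Bool → 𝒳,
      Continuous g ∧ range g = {x | IsLittlestoneTree f 0 n x} := by
    intro n
    have := analyticSet_isLittlestoneTree_zero hf n
    rw [AnalyticSet] at this
    refine this.resolve_left (Set.nonempty_iff_ne_empty.1 ?_)
    exact exists_isLittlestoneTree h n 0 (Ordinal.omega_pos 1)
  choose g hgc hg using hpar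
  let S : ∀ n : ℕ, {p : ℕ → ℕ → ℕ // ∀ α < ω₁, HasCodedTree f g n p α} := fun n =>
    Nat.rec ⟨0, fun α hα => by
      obtain ⟨x, hx⟩ := exists_isLittlestoneTree h 0 α hα
      exact ⟨x, hx, 0, by simp⟩⟩
      (fun n p => ⟨(HasCodedTree.exists_extension hg p.2).choose,
        (HasCodedTree.exists_extension hg p.2).choose_spec.2⟩) n
  have hSsucc : ∀ n, ∀ i < n, ∀ j < n, (S (n + 1)).1 i j = (S n).1 i j := fun n =>
    (HasCodedTree.exists_extension hg (S n).2).choose_spec.1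
  have hSle : ∀ m n, m ≤ n → ∀ i < m, ∀ j < m, (S n).1 i j = (S m).1 i j := by
    intro m n hmn i hi j hj
    induction n, hmn using Nat.le_induction with
    | base => rfl
    | succ n hmn ih => rw [hSsucc n i (by omega) j (by omega), ih]
  let Z : ℕ → ℕ → ℕ := fun i j => (S (max i j + 1)).1 i j
  choose x hx z hzx hzS using fun n => (S n).2 0 (Ordinal.omega_pos 1)
  have hlim : ∀ i, Tendsto (fun n => z n i) atTop (𝓝 (Z i)) := by
    intro i
    refine tendsto_pi_nhds.2 fun j => tendsto_const_nhds.congr' ?_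
    filter_upwards [eventually_ge_atTop (max i j + 1)] with n hn
    rw [hzS n i (by omega) j (by omega), hSle _ n hn i (by omega) j (by omega)]
  have hcoh : ∀ (u : List Bool) (i j : ℕ), u.length < i → u.length < j →
      g i (Z i) u = g j (Z j) u := by
    intro u i j hi hj
    have hl : ∀ i, Tendsto (fun n => g i (z n i) u) atTop (𝓝 (g i (Z i) u)) := fun i =>
      ((continuous_apply u).comp (hgc i)).tendsto _ |>.comp (hlim i)
    refine tendsto_nhds_unique (hl i) ((hl j).congr' ?_)
    filter_upwards [eventually_ge_atTop (max i j)] with n hn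
    rw [hzx n i (by omega) u hi, hzx n j (by omega) u hj]
  refine ⟨fun u => g (u.length + 1) (Z (u.length + 1)) u, fun y n => ?_⟩
  have hmem : g (n + 1) (Z (n + 1)) ∈ {x | IsLittlestoneTree f 0 (n + 1) x} := by
    rw [← hg]
    exact mem_range_self _
  obtain ⟨θ, hθ⟩ := (hmem y).nonempty
  refine ⟨f θ, mem_range_self θ, fun k hk => ?_⟩
  rw [← hθ k (by omega)]
  congr 1
  exact hcoh _ _ _ (by simp) (by simpa using by omega)

end Tree

theorem measure_pi_add_le [MeasurableSpace 𝒳] {P : Measure (𝒳 × Bool)} [IsProbabilityMeasure P]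
    (A : ∀ n, Set (Fin n → 𝒳 × Bool))
    (hA : ∀ (m n : ℕ) (e : Fin m → Fin n), ∀ s ∈ A n, s ∘ e ∈ A m) (m n : ℕ) :
    (Measure.pi fun _ : Fin (m + n) => P) (A (m + n)) ≤
      (Measure.pi fun _ : Fin m => P) (A m) * (Measure.pi fun _ : Fin n => P) (A n) := by
  have h1 := measurePreserving_piCongrLeft (fun _ : Fin (m + n) => P) (finSumFinEquiv (m := m))
  have h2 := measurePreserving_sumPiEquivProdPi_symm (fun _ : Fin m ⊕ Fin n => P)
  have h := h1.comp h2
  rw [← Measure.prod_prod, ← h.measure_preimage_emb (MeasurableEquiv.measurableEmbedding _ |>.comp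
    (MeasurableEquiv.measurableEmbedding _))]
  refine measure_mono fun q hq => ⟨?_, ?_⟩
  · convert hA _ _ (Fin.castAdd n) _ hq using 1
    ext i : 1
    exact (Equiv.piCongrLeft_apply_apply (fun _ : Fin (m + n) => 𝒳 × Bool) finSumFinEquiv
      ((MeasurableEquiv.sumPiEquivProdPi _).symm q) (Sum.inl i)).symm
  · convert hA _ _ (Fin.natAdd m) _ hq using 1
    ext i : 1
    exact (Equiv.piCongrLeft_apply_apply (fun _ : Fin (m + n) => 𝒳 × Bool) finSumFinEquiv
      ((MeasurableEquiv.sumPiEquivProdPi _).symm q) (Sum.inr i)).symm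

/-- Sub-multiplicativity gives exponential decay. -/
theorem exists_exponential_bound {a : ℕ → ENNReal} (h1 : ∀ n, a n ≤ 1)
    (hmul : ∀ m n, a (m + n) ≤ a m * a n) {n₀ : ℕ} (h0 : a n₀ < 1) :
    ∃ C > (0 : ℝ), ∃ c > (0 : ℝ), ∀ n : ℕ, a n ≤ ENNReal.ofReal (C * Real.exp (-c * n)) := by
  have hanti : Antitone a := antitone_nat_of_succ_le fun n => (hmul n 1).trans <|
    (mul_le_mul_right (h1 1) _).trans_eq (mul_one _)
  set N := n₀ + 1
  have hN : a N < 1 := (hanti (Nat.le_succ n₀)).trans_lt h0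
  have hpow : ∀ k, a (k * N) ≤ a N ^ k := by
    intro k
    induction k with
    | zero => simpa using h1 0
    | succ k ih =>
      rw [add_mul, one_mul, pow_succ]
      exact (hmul _ _).trans (mul_le_mul_left ih _)
  obtain ⟨r, hr0, hr1, hr⟩ : ∃ r : ℝ, 0 < r ∧ r < 1 ∧ a N ≤ ENNReal.ofReal r := by
    refine ⟨max (a N).toReal (1 / 2), by positivity, ?_, ?_⟩
    · refine max_lt ?_ (by norm_num)
      have := (ENNReal.toReal_lt_toReal hN.ne_top ENNReal.one_ne_top).2 hN
      simpa using this
    · rw [← ENNReal.ofReal_toReal hN.ne_top]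
      exact ENNReal.ofReal_le_ofReal (by simp)
  have hNpos : (0 : ℝ) < N := by positivity
  have hlog : Real.log r < 0 := Real.log_neg hr0 hr1
  refine ⟨r⁻¹, by positivity, -Real.log r / N, div_pos (by linarith) hNpos, fun n => ?_⟩
  calc a n ≤ a (n / N * N) := hanti (Nat.div_mul_le_self n N)
    _ ≤ a N ^ (n / N) := hpow _
    _ ≤ ENNReal.ofReal r ^ (n / N) := by gcongr
    _ = ENNReal.ofReal (r ^ (n / N)) := (ENNReal.ofReal_pow hr0.le _).symm
    _ ≤ _ := by
      refine ENNReal.ofReal_le_ofReal ?_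
      have hdiv : (n : ℝ) / N ≤ (n / N : ℕ) + 1 := by
        rw [div_le_iff₀ hNpos]
        rw [mul_comm]
        exact_mod_cast (Nat.lt_mul_div_succ n (Nat.succ_pos n₀)).le
      calc r ^ (n / N) = Real.exp (Real.log r * (n / N : ℕ)) := by
            rw [← Real.rpow_natCast, Real.rpow_def_of_pos hr0]
        _ ≤ Real.exp (-Real.log r + -(-Real.log r / N) * n) := by
            refine Real.exp_le_exp.2 ?_
            have : -(-Real.log r / N) * n = Real.log r * (n / N) := by ring
            rw [this]
            nlinarith
        _ = r⁻¹ * Real.exp (-(-Real.log r / N) * n) := by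
            rw [Real.exp_add, Real.exp_neg, Real.exp_log hr0]

theorem expErr_le [MeasurableSpace 𝒳] {P : Measure (𝒳 × Bool)} [IsProbabilityMeasure P]
    (A : LearningAlgorithm 𝒳) (n : ℕ) :
    expErr P A n ≤ (Measure.pi fun _ : Fin n => P) {s | 0 < errP P (A.H n s)} := by
  refine le_trans (lintegral_mono fun s => ?_) (lintegral_indicator_one_le _)
  by_cases hs : 0 < errP P (A.H n s)
  · rw [indicator_of_mem (show s ∈ {s | 0 < errP P (A.H n s)} from hs)]
    exact prob_le_one
  · simp [not_lt.1 hs]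

theorem Realizable.ae_nonempty_versionSpace {Θ : Type*} {f : Θ → 𝒳 → Bool} [MeasurableSpace Θ]
    [MeasurableSpace 𝒳] {P : Measure (𝒳 × Bool)} [IsProbabilityMeasure P]
    (hf : Measurable (Function.uncurry f))
    (hP : Realizable (range f) P) (n : ℕ) :
    ∀ᵐ s ∂Measure.pi fun _ : Fin n => P, (versionSpace f s).Nonempty := by
  rw [ae_iff]
  have hle : ∀ θ, (Measure.pi fun _ : Fin n => P) {s | ¬ (versionSpace f s).Nonempty} ≤
      n * errP P (f θ) := by
    intro θ
    have hm : MeasurableSet {p : 𝒳 × Bool | f θ p.1 ≠ p.2} := by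
      have hg : Measurable fun p : 𝒳 × Bool => (θ, p.1) := by fun_prop
      exact (measurableSet_eq_fun (hf.comp hg) measurable_snd).compl
    calc _ ≤ (Measure.pi fun _ : Fin n => P)
          (⋃ i : Fin n, Function.eval i ⁻¹' {p : 𝒳 × Bool | f θ p.1 ≠ p.2}) := by
          refine measure_mono fun s hs => ?_
          by_contra hcon
          refine hs ⟨θ, fun i => ?_⟩
          simpa using fun h => hcon (mem_iUnion.2 ⟨i, h⟩)
      _ ≤ ∑ i : Fin n, (Measure.pi fun _ : Fin n => P)
          (Function.eval i ⁻¹' {p : 𝒳 × Bool | f θ p.1 ≠ p.2}) := measure_iUnion_fintype_le _ _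
      _ = n * errP P (f θ) := by
          simp_rw [(measurePreserving_eval (fun _ : Fin n => P) _).measure_preimage
            hm.nullMeasurableSet]
          simp [errP]
  rw [Realizable, iInf_range] at hP
  have : Nonempty Θ := by
    by_contra hΘ
    rw [not_nonempty_iff] at hΘ
    rw [iInf_of_empty] at hP
    exact ENNReal.top_ne_zero hP
  refine le_antisymm ?_ zero_le
  calc _ ≤ ⨅ θ, n * errP P (f θ) := le_iInf hle
    _ = n * ⨅ θ, errP P (f θ) := (ENNReal.mul_iInf (by simp)).symm
    _ = 0 := by rw [hP, mul_zero]

section Learning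

variable {Θ : Type*} {f : Θ → 𝒳 → Bool}

/-- The optimal prediction at `x`: `true` iff, among the first `α` ordinals, the dimension of the
version space after the label `true` is at least that after the label `false`. -/
noncomputable def optimalPrediction (f : Θ → 𝒳 → Bool) (α : Ordinal.{0}) {n : ℕ}
    (s : Fin n → 𝒳 × Bool) (x : 𝒳) : Bool := by
  classical exact decide (∀ γ < α,
    LittlestoneDimGE f γ (versionSpace f (Fin.cons (x, false) s : Fin (n + 1) → 𝒳 × Bool)) →
    LittlestoneDimGE f γ (versionSpace f (Fin.cons (x, true) s : Fin (n + 1) → 𝒳 × Bool)))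

theorem optimalPrediction_eq {α β : Ordinal.{0}} (hβ : β < α) {n : ℕ} {s : Fin n → 𝒳 × Bool}
    {x : 𝒳} {y : Bool}
    (hy : LittlestoneDimGE f β (versionSpace f (Fin.cons (x, y) s : Fin (n + 1) → 𝒳 × Bool)))
    (hs : ¬ ∀ b,
      LittlestoneDimGE f β (versionSpace f (Fin.cons (x, b) s : Fin (n + 1) → 𝒳 × Bool))) :
    optimalPrediction f α s x = y := by
  rw [Bool.forall_bool] at hs
  cases y with
  | false => simpa [optimalPrediction] using ⟨β, hβ, hy, fun h => hs ⟨hy, h⟩⟩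
  | true =>
    simp only [optimalPrediction, decide_eq_true_eq]
    intro γ hγ h
    refine hy.anti (le_of_lt (lt_of_not_ge fun hle => hs ⟨h.anti hle, hy⟩))

theorem LittlestoneDimGE.comp {α : Ordinal.{0}} {m n : ℕ} {s : Fin n → 𝒳 × Bool}
    (h : LittlestoneDimGE f α (versionSpace f s)) (e : Fin m → Fin n) :
    LittlestoneDimGE f α (versionSpace f (s ∘ e)) :=
  h.mono fun _ hθ i => hθ (e i)

variable [TopologicalSpace Θ] [PolishSpace Θ] [MeasurableSpace Θ]
  [BorelSpace Θ] [TopologicalSpace 𝒳] [PolishSpace 𝒳] [MeasurableSpace 𝒳] [BorelSpace 𝒳]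

theorem universallyMeasurable_optimalPrediction (hf : Measurable (Function.uncurry f))
    {α : Ordinal.{0}} (hα : α < ω₁) (n : ℕ) : UniversallyMeasurable
      fun q : (Fin n → 𝒳 × Bool) × 𝒳 => optimalPrediction f α q.1 q.2 := by
  intro μ _
  have hR : ∀ γ < α, ∀ b, NullMeasurableSet {q : (Fin n → 𝒳 × Bool) × 𝒳 |
      LittlestoneDimGE f γ
        (versionSpace f (Fin.cons (q.2, b) q.1 : Fin (n + 1) → 𝒳 × Bool))} μ := by
    intro γ hγ b
    refine analyticSet_nullMeasurableSet (s := (fun q : (Fin n → 𝒳 × Bool) × 𝒳 =>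
      (Fin.cons (q.2, b) q.1 : Fin (n + 1) → 𝒳 × Bool)) ⁻¹'
        {s | LittlestoneDimGE f γ (versionSpace f s)}) ?_ μ
    exact (analyticSet_littlestoneDimGE hf (hγ.trans hα) (n + 1)).preimage (by fun_prop)
  have htrue : NullMeasurableSet {q : (Fin n → 𝒳 × Bool) × 𝒳 |
      optimalPrediction f α q.1 q.2 = true} μ := by
    have : {q : (Fin n → 𝒳 × Bool) × 𝒳 | optimalPrediction f α q.1 q.2 = true} =
        ⋂ γ ∈ Iio α, ({q | LittlestoneDimGE f γ
          (versionSpace f (Fin.cons (q.2, false) q.1 : Fin (n + 1) → 𝒳 × Bool))}ᶜ ∪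
          {q | LittlestoneDimGE f γ
          (versionSpace f (Fin.cons (q.2, true) q.1 : Fin (n + 1) → 𝒳 × Bool))}) := by
      ext q
      simp [optimalPrediction, imp_iff_not_or]
    rw [this]
    exact .biInter (countable_Iio_of_lt_omega_one hα) fun γ hγ =>
      (hR γ hγ false).compl.union (hR γ hγ true)
  intro t _
  have hsingle : ∀ b, NullMeasurableSet {q : (Fin n → 𝒳 × Bool) × 𝒳 |
      optimalPrediction f α q.1 q.2 = b} μ := by
    rintro (_ | _)
    · convert! htrue.compl using 1
      ext q
      simp
    · exact htrue
  have hpre : (fun q : (Fin n → 𝒳 × Bool) × 𝒳 => optimalPrediction f α q.1 q.2) ⁻¹' t =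
      ⋃ b ∈ t, {q | optimalPrediction f α q.1 q.2 = b} := by
    ext q
    simp
  rw [hpre]
  exact .biUnion t.to_countable fun b _ => hsingle b

variable {P : Measure (𝒳 × Bool)} [IsProbabilityMeasure P]

theorem exists_exponential_bound_optimalPrediction (hf : Measurable (Function.uncurry f))
    {α : Ordinal.{0}} (hα : α < ω₁) (hα' : ¬ LittlestoneDimGE f α univ)
    (hP : Realizable (range f) P) :
    ∃ C > (0 : ℝ), ∃ c > (0 : ℝ), ∀ n : ℕ, (Measure.pi fun _ : Fin n => P)
      {s : Fin n → 𝒳 × Bool | 0 < errP P (optimalPrediction f α s)} ≤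
        ENNReal.ofReal (C * Real.exp (-c * n)) := by
  let A : Ordinal.{0} → ∀ n, Set (Fin n → 𝒳 × Bool) := fun β n =>
    {s | LittlestoneDimGE f β (versionSpace f s)}
  have h0 : (Measure.pi fun _ : Fin 0 => P) (A α 0) < 1 := by
    have : A α 0 = ∅ := eq_empty_of_forall_notMem fun s hs => hα' (hs.mono (subset_univ _))
    simp [this]
  obtain ⟨β, ⟨n₀, hn₀⟩, hmin⟩ := WellFounded.has_min (wellFounded_lt (α := Ordinal.{0}))
    {β | ∃ n, (Measure.pi fun _ : Fin n => P) (A β n) < 1} ⟨α, 0, h0⟩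
  have hβα : β ≤ α := not_lt.1 fun h => hmin α ⟨0, h0⟩ h
  have hae : ∀ n, ∀ᵐ s ∂Measure.pi fun _ : Fin n => P, ∀ γ < β, s ∈ A γ n := by
    intro n
    have := (ae_ball_iff (countable_Iio_of_lt_omega_one (hβα.trans_lt hα))
      (μ := Measure.pi fun _ : Fin n => P) (p := fun s γ _ => s ∈ A γ n)).2 fun γ hγ => by
        have hnull := analyticSet_nullMeasurableSet
          (analyticSet_littlestoneDimGE hf (hγ.trans_le hβα |>.trans hα) n)
          (Measure.pi fun _ : Fin n => P)
        refine (mem_ae_iff_prob_eq_one₀ hnull).2 (le_antisymm prob_le_one (not_lt.1 fun h => ?_))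
        exact hmin γ ⟨n, h⟩ hγ
    exact this
  obtain ⟨C, hC, c, hc, hbound⟩ := exists_exponential_bound
    (a := fun n => (Measure.pi fun _ : Fin n => P) (A β n)) (fun _ => prob_le_one)
    (measure_pi_add_le (A β) fun m n e s hs => hs.comp e) hn₀
  refine ⟨C, hC, c, hc, fun n => (measure_mono_ae ?_).trans (hbound n)⟩
  have hsucc := hae (n + 1)
  have hmp := (measurePreserving_piFinSuccAbove (fun _ : Fin (n + 1) => P) 0).symm
  have hprod := hmp.quasiMeasurePreserving.ae hsucc
  have hswap := Measure.ae_ae_of_ae_prod (Measure.measurePreserving_swap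
    (μ := Measure.pi fun _ : Fin n => P) (ν := P) |>.quasiMeasurePreserving.ae hprod)
  filter_upwards [hP.ae_nonempty_versionSpace hf n, hswap] with s hne hs herr
  by_contra hsβ
  obtain ⟨γ, hγ, hγs⟩ : ∃ γ < β, ∀ x, ¬ ∀ b,
      LittlestoneDimGE f γ (versionSpace f s ∩ {θ | f θ x = b}) := by
    by_contra! hcon
    exact hsβ (littlestoneDimGE_iff.2 ⟨hne, hcon⟩)
  refine herr.ne' (measure_eq_zero_iff_ae_notMem.2 ?_)
  filter_upwards [hs] with p hp
  refine not_not.2 ?_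
  refine optimalPrediction_eq (hγ.trans_le hβα) ?_ ?_
  · simpa [A, Fin.consEquiv] using hp γ hγ
  · simpa only [versionSpace_cons] using hγs p.1

end Learning

end Auxiliary

/-- **Corollary 4.5 (exponential upper bound).** If a measurable concept class `ℋ` on a Polish
space has no infinite Littlestone tree, then there is a learning algorithm such that for every
realizable `P` there are `C, c > 0` with `P^{⊗n}{er_P(ĥ_n) > 0} ≤ C e^{-cn}` for all `n`; in
particular `E[er_P(ĥ_n)] ≤ C e^{-cn}` for all `n`, so `ℋ` is learnable at rate `e^{-n}`. -/
theorem exponential_upper_bound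
    (𝒳 : Type*) [TopologicalSpace 𝒳] [PolishSpace 𝒳] [MeasurableSpace 𝒳] [BorelSpace 𝒳]
    (ℋ : Set (𝒳 → Bool)) (hmeas : MeasurableClass 𝒳 ℋ)
    (htree : ¬ HasInfiniteLittlestoneTree ℋ) :
    (∃ A : LearningAlgorithm 𝒳,
      ∀ P : MeasureTheory.Measure (𝒳 × Bool),
        MeasureTheory.IsProbabilityMeasure P → Realizable ℋ P →
          ∃ C > (0 : ℝ), ∃ c > (0 : ℝ), ∀ n : ℕ,
            (MeasureTheory.Measure.pi fun _ : Fin n => P)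
                {s : Fin n → 𝒳 × Bool | 0 < errP P (A.H n s)}
              ≤ ENNReal.ofReal (C * Real.exp (-c * n)) ∧
            expErr P A n ≤ ENNReal.ofReal (C * Real.exp (-c * n))) ∧
    LearnableAtRate ℋ (fun n => Real.exp (-(n : ℝ))) := by
  have hA : ∃ A : LearningAlgorithm 𝒳,
      ∀ P : MeasureTheory.Measure (𝒳 × Bool),
        MeasureTheory.IsProbabilityMeasure P → Realizable ℋ P →
          ∃ C > (0 : ℝ), ∃ c > (0 : ℝ), ∀ n : ℕ,
            (MeasureTheory.Measure.pi fun _ : Fin n => P)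
                {s : Fin n → 𝒳 × Bool | 0 < errP P (A.H n s)}
              ≤ ENNReal.ofReal (C * Real.exp (-c * n)) ∧
            expErr P A n ≤ ENNReal.ofReal (C * Real.exp (-c * n)) := by
    obtain ⟨Θ, f, hf, rfl⟩ := hmeas
    obtain ⟨α, hα, hα'⟩ : ∃ α < Ordinal.omega 1, ¬ LittlestoneDimGE f α Set.univ := by
      by_contra! hcon
      exact htree (hasInfiniteLittlestoneTree_of_forall_littlestoneDimGE hf hcon)
    refine ⟨⟨fun n s => optimalPrediction f α s,
      fun n => universallyMeasurable_optimalPrediction hf hα n⟩, fun P _ hP => ?_⟩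
    obtain ⟨C, hC, c, hc, h⟩ := exists_exponential_bound_optimalPrediction hf hα hα' hP
    exact ⟨C, hC, c, hc, fun n => ⟨h n, (expErr_le _ n).trans (h n)⟩⟩
  refine ⟨hA, ?_⟩
  obtain ⟨A, hA⟩ := hA
  refine ⟨A, fun P hP hr => ?_⟩
  obtain ⟨C, hC, c, hc, h⟩ := hA P hP hr
  refine ⟨C * Real.exp 1, by positivity, c, hc, fun n => (h n).2.trans ?_⟩
  refine ENNReal.ofReal_le_ofReal ?_
  rw [mul_assoc, ← Real.exp_add]
  have hceil := Nat.ceil_lt_add_one (show 0 ≤ c * (n : ℝ) by positivity)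
  gcongr
  linarith
end

section
/- Lemma 5.1: Let 𝒳 be a Polish space and ℋ a measurable concept class. If ℋ has no infinite VCL tree, then player P_L has a winning strategy in the game 𝔙 given by maps η_τ : 𝒳^1 × 𝒳^2 × ⋯ × 𝒳^τ → {0,1}^τ (τ ≥ 1) each of which is universally measurable. -/
variable {𝒳 : Type*}

section

open Set Function MeasureTheory Topology

namespace MeasureTheory

/-- If the cylinders `{z | ∀ i < k, z i ≤ g i}` all meet a closed set of the Baire space, then so
does their (compact) intersection. -/
theorem exists_le_mem_of_isClosed {D : Set (ℕ → ℕ)} (hD : IsClosed D) (g : ℕ → ℕ)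
    (h : ∀ k, ∃ z ∈ D, ∀ i < k, z i ≤ g i) : ∃ z ∈ D, z ≤ g := by
  choose z hzD hz using h
  have hK : IsCompact (Set.Icc (0 : ℕ → ℕ) g) := by
    rw [← Set.pi_univ_Icc]
    exact isCompact_univ_pi fun i => (Set.finite_Icc _ _).isCompact
  obtain ⟨a, ha, φ, hφ, hlim⟩ := hK.tendsto_subseq (x := fun k i => if i < k then z k i else 0)
    fun k => ⟨fun i => Nat.zero_le _, fun i => by
      by_cases hi : i < k
      · simpa [hi] using hz k i hi
      · simp [hi]⟩
  refine ⟨a, hD.mem_of_tendsto (b := Filter.atTop) (f := z ∘ φ) ?_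
    (Filter.Eventually.of_forall fun k => hzD _), ha.2⟩
  rw [tendsto_pi_nhds] at hlim ⊢
  intro i
  refine (hlim i).congr' ?_
  filter_upwards [Filter.eventually_gt_atTop i] with k hk
  simp [hk.trans_le hφ.le_apply]

variable {X : Type*} [TopologicalSpace X] [T2Space X] [MeasurableSpace X] [OpensMeasurableSpace X]

theorem exists_isCompact_subset_range_le_measure (μ : Measure X) [IsFiniteMeasure μ]
    {f : (ℕ → ℕ) → X} (hf : Continuous f) {c : ENNReal} (hc : c < μ (range f)) :
    ∃ K ⊆ range f, IsCompact K ∧ c ≤ μ K := by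
  have step : ∀ (k : ℕ) (S : Set (ℕ → ℕ)), ∃ m : ℕ, c < μ (f '' S) →
      c < μ (f '' (S ∩ {z | z k ≤ m})) := by
    intro k S
    by_cases h : c < μ (f '' S)
    · have hU : f '' S = ⋃ m : ℕ, f '' (S ∩ {z | z k ≤ m}) := by
        rw [← image_iUnion, ← inter_iUnion]
        congr 1
        refine (inter_eq_left.2 fun z _ => mem_iUnion.2 ⟨z k, le_refl (z k)⟩).symm
      have hm : Monotone fun m : ℕ => f '' (S ∩ {z | z k ≤ m}) := fun a b hab =>
        image_mono (inter_subset_inter_right _ fun z (hz : z k ≤ a) => hz.trans hab)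
      rw [hU, hm.measure_iUnion] at h
      obtain ⟨m, hm⟩ := lt_iSup_iff.1 h
      exact ⟨m, fun _ => hm⟩
    · exact ⟨0, fun h' => absurd h' h⟩
  choose m hm using step
  let S : ℕ → Set (ℕ → ℕ) := fun k => Nat.rec univ (fun k S => S ∩ {z | z k ≤ m k S}) k
  have hS : ∀ k, c < μ (f '' S k) := by
    intro k
    induction k with
    | zero => simpa [S] using hc
    | succ k ih => exact hm k _ ih
  let g : ℕ → ℕ := fun k => m k (S k)
  have hSg : ∀ k, S k = {z | ∀ i < k, z i ≤ g i} := by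
    intro k
    induction k with
    | zero => simp [S]
    | succ k ih =>
      change S k ∩ {z | z k ≤ g k} = _
      rw [ih]
      ext z
      simp only [mem_inter_iff, mem_ofPred_eq, Nat.lt_succ_iff_lt_or_eq]
      grind
  have hK : IsCompact (f '' Set.Iic g) := by
    have : Set.Iic g = Set.Icc 0 g := by
      ext z
      exact ⟨fun h => ⟨fun i => Nat.zero_le _, h⟩, fun h => h.2⟩
    rw [this, ← Set.pi_univ_Icc]
    exact (isCompact_univ_pi fun i => (Set.finite_Icc _ _).isCompact).image hf
  refine ⟨f '' Set.Iic g, image_subset_range _ _, hK, ?_⟩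
  have hsub : ⋂ k, closure (f '' S k) ⊆ f '' Set.Iic g := by
    intro x hx
    by_contra hxK
    obtain ⟨U, V, hU, hV, hxU, hKV, hUV⟩ :=
      SeparatedNhds.of_isCompact_isCompact isCompact_singleton hK (disjoint_singleton_left.2 hxK)
    obtain ⟨z, hzV, hzg⟩ := exists_le_mem_of_isClosed (hV.preimage hf).isClosed_compl g fun k => by
      obtain ⟨_, hyU, z, hz, rfl⟩ := mem_closure_iff.1 (mem_iInter.1 hx k) U hU (hxU rfl)
      rw [hSg] at hz
      exact ⟨z, fun hzV => disjoint_left.1 hUV hyU hzV, hz⟩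
    exact hzV (hKV ⟨z, hzg, rfl⟩)
  have hanti : Antitone fun k => closure (f '' S k) :=
    antitone_nat_of_succ_le fun k => closure_mono (image_mono inter_subset_left)
  calc c ≤ ⨅ k, μ (closure (f '' S k)) :=
        le_iInf fun k => (hS k).le.trans (measure_mono subset_closure)
    _ = μ (⋂ k, closure (f '' S k)) :=
        (hanti.measure_iInter (fun k => isClosed_closure.measurableSet.nullMeasurableSet)
          ⟨0, measure_ne_top _ _⟩).symm
    _ ≤ _ := measure_mono hsub

/-- Analytic sets are measurable for the completion of every finite Borel measure. -/
theorem AnalyticSet.nullMeasurableSet {s : Set X} (hs : AnalyticSet s) (μ : Measure X)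
    [IsFiniteMeasure μ] : NullMeasurableSet s μ := by
  rw [AnalyticSet] at hs
  obtain rfl | ⟨f, hf, rfl⟩ := hs
  · exact nullMeasurableSet_empty
  obtain h0 | h0 := eq_or_ne (μ (range f)) 0
  · exact NullMeasurableSet.of_null h0
  obtain ⟨c, -, hc, hlim⟩ := exists_seq_strictMono_tendsto' (pos_iff_ne_zero.2 h0)
  choose K hKs hK hcK using fun n => exists_isCompact_subset_range_le_measure μ hf (hc n).2
  have hKm : MeasurableSet (⋃ n, K n) := MeasurableSet.iUnion fun n => (hK n).measurableSet
  refine NullMeasurableSet.congr hKm.nullMeasurableSet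
    (ae_eq_of_subset_of_measure_ge (iUnion_subset hKs) ?_ hKm.nullMeasurableSet
      (measure_ne_top _ _))
  exact le_of_tendsto' hlim fun n => (hcK n).trans (measure_mono (subset_iUnion K n))

theorem AnalyticSet.exists_isClosed_prod {X : Type*} [TopologicalSpace X] [T2Space X]
    {s : Set X} (hs : AnalyticSet s) :
    ∃ K : Set ((ℕ → ℕ) × X), IsClosed K ∧ ∀ x, x ∈ s ↔ ∃ z, (z, x) ∈ K := by
  rw [AnalyticSet] at hs
  obtain rfl | ⟨f, hf, rfl⟩ := hs
  · exact ⟨∅, isClosed_empty, by simp⟩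
  · exact ⟨{p | f p.1 = p.2}, isClosed_eq (hf.comp continuous_fst) continuous_snd, by simp⟩

theorem AnalyticSet.iInter_of_polishSpace {X ι : Type*} [TopologicalSpace X] [PolishSpace X]
    [Countable ι] {s : ι → Set X} (hs : ∀ i, AnalyticSet (s i)) : AnalyticSet (⋂ i, s i) := by
  cases isEmpty_or_nonempty ι
  · rw [iInter_of_empty]
    exact isClosed_univ.analyticSet
  · exact AnalyticSet.iInter hs

end MeasureTheory

/-- A set is universally measurable if it is measurable for the completion of every Borel
probability measure. -/
def UniversallyMeasurableSet {X : Type*} [MeasurableSpace X] (s : Set X) : Prop :=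
  ∀ μ : Measure X, IsProbabilityMeasure μ → NullMeasurableSet s μ

namespace UniversallyMeasurableSet

variable {X Y : Type*} [MeasurableSpace X] [MeasurableSpace Y] {s t : Set X}

theorem compl (hs : UniversallyMeasurableSet s) : UniversallyMeasurableSet sᶜ :=
  fun μ hμ => (hs μ hμ).compl

theorem inter (hs : UniversallyMeasurableSet s) (ht : UniversallyMeasurableSet t) :
    UniversallyMeasurableSet (s ∩ t) :=
  fun μ hμ => (hs μ hμ).inter (ht μ hμ)

theorem iInter {ι : Sort*} [Countable ι] {s : ι → Set X}
    (hs : ∀ i, UniversallyMeasurableSet (s i)) : UniversallyMeasurableSet (⋂ i, s i) :=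
  fun μ hμ => NullMeasurableSet.iInter fun i => hs i μ hμ

theorem iUnion {ι : Sort*} [Countable ι] {s : ι → Set X}
    (hs : ∀ i, UniversallyMeasurableSet (s i)) : UniversallyMeasurableSet (⋃ i, s i) :=
  fun μ hμ => NullMeasurableSet.iUnion fun i => hs i μ hμ

theorem imp (hs : UniversallyMeasurableSet s) (ht : UniversallyMeasurableSet t) :
    UniversallyMeasurableSet {x | x ∈ s → x ∈ t} := by
  have : {x | x ∈ s → x ∈ t} = (s ∩ tᶜ)ᶜ := by
    ext x
    simp
  rw [this]
  exact (hs.inter ht.compl).compl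

theorem preimage (hs : UniversallyMeasurableSet s) {f : Y → X} (hf : Measurable f) :
    UniversallyMeasurableSet (f ⁻¹' s) := fun μ _ =>
  (hs (μ.map f) (Measure.isProbabilityMeasure_map hf.aemeasurable)).preimage
    ⟨hf, Measure.AbsolutelyContinuous.rfl⟩

/-- A countable cover by universally measurable sets admits a universally measurable selector. -/
theorem exists_selector {B : Type*} [Countable B] {S : B → Set X}
    (hS : ∀ b, UniversallyMeasurableSet (S b)) (hcover : ∀ x, ∃ b, x ∈ S b) :
    ∃ f : X → B, (∀ b, UniversallyMeasurableSet {x | f x = b}) ∧ ∀ x, x ∈ S (f x) := by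
  obtain ⟨c, hc⟩ := exists_injective_nat B
  have key : ∀ x, ∃ b, x ∈ S b ∧ ∀ b', c b' < c b → x ∉ S b' := by
    intro x
    obtain ⟨b, hb, hmin⟩ := (InvImage.wf c Nat.lt_wfRel.wf).has_min {b | x ∈ S b} (hcover x)
    exact ⟨b, hb, fun b' hlt hb' => hmin b' hb' hlt⟩
  choose f hfS hfmin using key
  refine ⟨f, fun b => ?_, hfS⟩
  have : {x | f x = b} = S b ∩ ⋂ b', ⋂ _ : c b' < c b, (S b')ᶜ := by
    ext x
    simp only [mem_inter_iff, mem_iInter, mem_compl_iff]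
    constructor
    · rintro rfl
      exact ⟨hfS x, hfmin x⟩
    · rintro ⟨hb, hmin⟩
      refine hc (le_antisymm ?_ ?_)
      · exact not_lt.1 fun h => hfmin x b h hb
      · exact not_lt.1 fun h => hmin _ h (hfS x)
  rw [this]
  exact (hS b).inter (iInter fun b' => iInter fun _ => (hS b').compl)

end UniversallyMeasurableSet

theorem MeasureTheory.AnalyticSet.universallyMeasurableSet {X : Type*} [TopologicalSpace X]
    [T2Space X] [MeasurableSpace X] [OpensMeasurableSpace X] {s : Set X} (hs : AnalyticSet s) :
    UniversallyMeasurableSet s :=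
  fun μ _ => hs.nullMeasurableSet μ

theorem UniversallyMeasurable.of_fiber {X Y : Type*} [MeasurableSpace X] [MeasurableSpace Y]
    [Countable Y] {f : X → Y} (hf : ∀ y, UniversallyMeasurableSet {x | f x = y}) :
    UniversallyMeasurable f := by
  intro μ hμ s _
  have : f ⁻¹' s = ⋃ y : s, {x | f x = y} := by
    ext x
    simp
  rw [this]
  exact NullMeasurableSet.iUnion fun y => hf y μ hμ

/-- A form of the Kunen–Martin theorem: a decreasing sequence of closed sets in `J → ℕ` with empty
intersection carries rank functions `ρ N`, bounded by a countable ordinal, that strictly decrease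
along extensions of the finite pieces of data indexed by `F N`. -/
theorem exists_rank_of_iInter_eq_empty {J : Type} (F : ℕ → Set J)
    (hfin : ∀ N, (F N).Finite) (hmono : Monotone F) (hF : ∀ j, ∃ N, j ∈ F N)
    (G : ℕ → Set (J → ℕ)) (hclosed : ∀ N, IsClosed (G N)) (hanti : Antitone G)
    (hempty : ¬ ∃ q, ∀ N, q ∈ G N) :
    ∃ (ρ : ℕ → (J → ℕ) → Ordinal.{0}) (κ : Ordinal.{0}), (Iio κ).Countable ∧
      (∀ N q, ρ N q < κ) ∧
      ∀ N q q', (∀ j ∈ F N, q j = q' j) → q' ∈ G (N + 1) → ρ (N + 1) q' < ρ N q := by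
  have _ (N : ℕ) : Finite (F N) := hfin N
  let node : ℕ → (J → ℕ) → Σ N, F N → ℕ := fun N q => ⟨N, fun j => q j⟩
  have node_eq : ∀ {N N' q q'}, node N q = node N' q' → N = N' ∧ ∀ j ∈ F N, q j = q' j := by
    intro N N' q q' h
    obtain rfl : N = N' := congrArg Sigma.fst h
    exact ⟨rfl, fun j hj => congrFun (eq_of_heq (Sigma.mk.inj h).2) ⟨j, hj⟩⟩
  let r : (Σ N, F N → ℕ) → (Σ N, F N → ℕ) → Prop := fun a b =>
    ∃ N, ∃ q ∈ G (N + 1), a = node (N + 1) q ∧ b = node N q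
  have hwf : IsWellFounded _ r := by
    rw [isWellFounded_iff, wellFounded_iff_isEmpty_descending_chain]
    refine ⟨fun ⟨f, hf⟩ => hempty ?_⟩
    choose N q hqG hq hq' using hf
    have hstep : ∀ k, N (k + 1) = N k + 1 ∧ ∀ j ∈ F (N k + 1), q (k + 1) j = q k j := by
      intro k
      obtain ⟨h1, h2⟩ := node_eq ((hq k).symm.trans (hq' (k + 1)))
      exact ⟨h1.symm, fun j hj => (h2 j hj).symm⟩
    have hN : ∀ k, k ≤ N k := by
      intro k
      induction k with
      | zero => exact Nat.zero_le _
      | succ k ih =>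
        rw [(hstep k).1]
        exact Nat.succ_le_succ ih
    have hstable : ∀ j, ∃ K, ∀ k ≥ K, q k j = q K j := by
      intro j
      obtain ⟨K, hK⟩ := hF j
      refine ⟨K, fun k hk => ?_⟩
      induction k, hk using Nat.le_induction with
      | base => rfl
      | succ k hk ih =>
        rw [(hstep k).2 j (hmono ((hk.trans (hN k)).trans (Nat.le_succ _)) hK), ih]
    choose K hK using hstable
    refine ⟨fun j => q (K j) j, fun M => ?_⟩
    refine (hclosed M).mem_of_tendsto (f := q) (b := Filter.atTop) ?_ ?_
    · rw [tendsto_pi_nhds]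
      intro j
      refine tendsto_const_nhds.congr' ?_
      filter_upwards [Filter.eventually_ge_atTop (K j)] with k hk
      exact (hK j k hk).symm
    · filter_upwards [Filter.eventually_ge_atTop M] with k hk
      exact hanti ((hk.trans (hN k)).trans (Nat.le_succ _)) (hqG k)
  refine ⟨fun N q => IsWellFounded.rank r (node N q),
    ⨆ a, Order.succ (IsWellFounded.rank r a), ?_, ?_, ?_⟩
  · refine (countable_range (IsWellFounded.rank r)).mono fun o ho => ?_
    obtain ⟨a, ha⟩ := (Ordinal.lt_iSup_iff).1 ho
    exact IsWellFounded.mem_range_rank_of_le (Order.lt_succ_iff.1 ha)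
  · intro N q
    exact Ordinal.lt_iSup_iff.2 ⟨_, Order.lt_succ _⟩
  · intro N q q' hqq' hq'
    refine IsWellFounded.rank_lt_of_rel ⟨N, q', hq', rfl, ?_⟩
    exact congrArg (Sigma.mk N) (funext fun j => hqq' j j.2)

/-! ### Open games with finite replies

In round `n`, the first player picks a point of `E n` and the second player replies with an element
of `B n`. The first player survives as long as, for all `n`, the first `n` moves lie in `C n y`,
where `y` are the first `n` replies. -/

namespace OpenGame

section Basic

variable {E : ℕ → Type*}

/-- The first `n` terms of a sequence. -/
abbrev initial (n : ℕ) (f : ∀ t, E t) : ∀ j : Fin n, E j := fun j => f j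

/-- Extend a finite sequence by default values. -/
def extend [∀ t, Inhabited (E t)] (n : ℕ) (v : ∀ j : Fin n, E j) : ∀ t, E t :=
  fun t => if h : t < n then v ⟨t, h⟩ else default

theorem initial_congr {n : ℕ} {f g : ∀ t, E t} (h : ∀ t < n, f t = g t) :
    initial n f = initial n g :=
  funext fun j => h j j.2

variable [∀ t, Inhabited (E t)]

theorem extend_of_lt {n t : ℕ} (v : ∀ j : Fin n, E j) (h : t < n) :
    extend n v t = v ⟨t, h⟩ :=
  dif_pos h

theorem extend_initial_of_lt {n t : ℕ} (f : ∀ t, E t) (h : t < n) :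
    extend n (initial n f) t = f t :=
  dif_pos h

theorem initial_extend (n : ℕ) (v : ∀ j : Fin n, E j) : initial n (extend n v) = v :=
  funext fun j => extend_of_lt v j.2

theorem continuous_extend [∀ t, TopologicalSpace (E t)] (n : ℕ) :
    Continuous (extend n : (∀ j : Fin n, E j) → ∀ t, E t) := by
  refine continuous_pi fun t => ?_
  by_cases h : t < n
  · simpa only [extend, h, dif_pos] using continuous_apply _
  · simpa only [extend, h, dif_neg, not_false_iff] using continuous_const

end Basic

variable {E : ℕ → Type*} {B : ℕ → Type}
  (C : ∀ n, (∀ j : Fin n, B j) → Set (∀ j : Fin n, E j))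

/-- The set of plays for which, after `n` rounds with replies `y`, the game value is at least `κ`,
i.e. the first player can keep the game alive for `κ` further rounds. -/
def survival (κ : Ordinal.{0}) (n : ℕ) (y : ∀ t, B t) : Set (∀ t, E t) :=
  {ξ | initial n ξ ∈ C n (initial n y) ∧ ∀ κ' < κ, ∃ e : E n, ∀ b : B n,
    update ξ n e ∈ survival κ' (n + 1) (update y n b)}
termination_by κ

variable {C}

theorem mem_survival {κ : Ordinal.{0}} {n : ℕ} {y : ∀ t, B t} {ξ : ∀ t, E t} :
    ξ ∈ survival C κ n y ↔ initial n ξ ∈ C n (initial n y) ∧ ∀ κ' < κ, ∃ e : E n, ∀ b : B n,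
      update ξ n e ∈ survival C κ' (n + 1) (update y n b) := by
  rw [survival]
  rfl

theorem survival_anti {κ κ' : Ordinal.{0}} (h : κ ≤ κ') (n : ℕ) (y : ∀ t, B t) :
    survival C κ' n y ⊆ survival C κ n y := by
  intro ξ hξ
  rw [mem_survival] at hξ ⊢
  exact ⟨hξ.1, fun o ho => hξ.2 o (ho.trans_le h)⟩

theorem update_congr_of_lt {E : ℕ → Type*} {n : ℕ} {f g : ∀ t, E t} (h : ∀ t < n, f t = g t)
    (e : E n) : ∀ t < n + 1, update f n e t = update g n e t := by
  intro t ht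
  obtain ht | rfl := Nat.lt_succ_iff_lt_or_eq.1 ht
  · rw [update_of_ne ht.ne, update_of_ne ht.ne, h t ht]
  · simp

theorem update_eq_of_lt {E : ℕ → Type*} {n : ℕ} {f g : ∀ t, E t} (h : ∀ t < n, f t = g t) :
    ∀ t < n + 1, update f n (g n) t = g t := by
  simpa only [update_eq_self] using update_congr_of_lt h (g n)

theorem survival_congr {κ : Ordinal.{0}} {n : ℕ} {y y' : ∀ t, B t} {ξ ξ' : ∀ t, E t}
    (hy : ∀ t < n, y t = y' t) (hξ : ∀ t < n, ξ t = ξ' t) (h : ξ ∈ survival C κ n y) :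
    ξ' ∈ survival C κ n y' := by
  induction κ using WellFoundedLT.induction generalizing n y y' ξ ξ' with
  | ind κ ih =>
    rw [mem_survival] at h ⊢
    rw [← initial_congr hy, ← initial_congr hξ]
    refine ⟨h.1, fun κ' hκ' => ?_⟩
    obtain ⟨e, he⟩ := h.2 κ' hκ'
    exact ⟨e, fun b => ih κ' hκ' (update_congr_of_lt hy b) (update_congr_of_lt hξ e) (he b)⟩

theorem analyticSet_survival [∀ t, TopologicalSpace (E t)] [∀ t, PolishSpace (E t)]
    [∀ t, Countable (B t)] (hC : ∀ n u, AnalyticSet (C n u)) {κ : Ordinal.{0}}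
    (hκ : (Iio κ).Countable) (n : ℕ) (y : ∀ t, B t) : AnalyticSet (survival C κ n y) := by
  induction κ using WellFoundedLT.induction generalizing n y with
  | ind κ ih =>
    have : Countable (Iio κ) := hκ
    have heq : survival C κ n y = ⋂ o : Option (Iio κ), o.elim
        (initial n ⁻¹' C n (initial n y)) fun κ' => Prod.fst '' ⋂ b : B n,
          (fun p : (∀ t, E t) × E n => update p.1 n p.2) ⁻¹'
            survival C κ' (n + 1) (update y n b) := by
      ext ξ
      rw [mem_survival]
      simp [Option.forall]
    rw [heq]
    refine AnalyticSet.iInter_of_polishSpace fun o => ?_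
    cases o with
    | none => exact (hC _ _).preimage (by fun_prop)
    | some κ' =>
      refine AnalyticSet.image_of_continuous
        (AnalyticSet.iInter_of_polishSpace fun b => AnalyticSet.preimage ?_ ?_) continuous_fst
      · exact ih κ' κ'.2 (hκ.mono (Iio_subset_Iio κ'.2.le)) _ _
      · exact continuous_fst.update n continuous_snd

/-- If the first player cannot survive forever along a tree of moves, then the value of the game
is a countable ordinal. -/
theorem exists_countable_forall_notMem_survival [∀ t, TopologicalSpace (E t)]
    [∀ t, PolishSpace (E t)] [∀ t, Inhabited (E t)] [∀ t, Finite (B t)] [∀ t, Inhabited (B t)]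
    (hC : ∀ n u, AnalyticSet (C n u))
    (htree : ¬ ∃ x : ∀ k, (∀ j : Fin k, B j) → E k, ∀ (y : ∀ t, B t) (n : ℕ),
      (fun k : Fin n => x k (initial k y)) ∈ C n (initial n y)) :
    ∃ κ : Ordinal.{0}, (Iio κ).Countable ∧ ∀ ξ y, ξ ∉ survival C κ 0 y := by
  let I := Σ n, ∀ j : Fin n, B j
  choose ψ hψ hψs using fun t => PolishSpace.exists_nat_nat_continuous_surjective (E t)
  choose K hK hCK using fun n u => (hC n u).exists_isClosed_prod
  let J := (I ⊕ I) × ℕ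
  obtain ⟨c, hc⟩ := exists_injective_nat J
  let level : I ⊕ I → ℕ := Sum.elim (fun i => i.1 + 1) fun i => i.1
  let F : ℕ → Set J := fun N => {j | level j.1 ≤ N ∧ c j < N}
  let leaf : (J → ℕ) → (∀ t, B t) → ∀ t, E t :=
    fun q y k => ψ k fun m => q (.inl ⟨k, initial k y⟩, m)
  let witness : (J → ℕ) → I → ℕ → ℕ := fun q i m => q (.inr i, m)
  let G : ℕ → Set (J → ℕ) := fun N => {q | ∀ n ≤ N, ∀ y : ∀ t, B t,
    (witness q ⟨n, initial n y⟩, initial n (leaf q y)) ∈ K n (initial n y)}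
  have leaf_congr : ∀ {q q' y y'} {t : ℕ}, (∀ s < t, y s = y' s) →
      (∀ u m, q (.inl ⟨t, u⟩, m) = q' (.inl ⟨t, u⟩, m)) → leaf q y t = leaf q' y' t := by
    intro q q' y y' t hy hq
    simp only [leaf, initial_congr hy, hq]
  have hG : ∀ N, IsClosed (G N) := by
    intro N
    simp only [G, ofPred_forall]
    refine isClosed_iInter fun n => isClosed_iInter fun _ => isClosed_iInter fun y =>
      (hK n _).preimage ?_
    refine Continuous.prodMk (by fun_prop) (continuous_pi fun j => (hψ j).comp ?_)
    fun_prop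
  obtain ⟨ρ, κ, hκ, hρκ, hρ⟩ := exists_rank_of_iInter_eq_empty F
    (fun N => ((Set.finite_Iio N).preimage hc.injOn).subset fun j hj => hj.2)
    (fun M N h j hj => ⟨hj.1.trans h, hj.2.trans_le h⟩)
    (fun j => ⟨max (level j.1) (c j + 1), le_max_left _ _, Nat.lt_of_succ_le (le_max_right _ _)⟩)
    G hG (fun M N h q hq n hn => hq n (hn.trans h)) (by
      rintro ⟨q, hq⟩
      exact htree ⟨fun k u => ψ k fun m => q (.inl ⟨k, u⟩, m), fun y n =>
        (hCK _ _ _).2 ⟨_, hq n n le_rfl y⟩⟩)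
  have main : ∀ κ N q, q ∈ G N → (∀ y, leaf q y ∈ survival C κ N y) → κ ≤ ρ N q := by
    intro κ
    induction κ using WellFoundedLT.induction with
    | ind κ ih =>
      intro N q hq hleaf
      refine le_of_forall_lt fun κ' hκ' => ?_
      have hw : ∀ i : I, ∃ w : ℕ → ℕ, i.1 = N → ∀ b,
          update (leaf q (extend i.1 i.2)) i.1 (ψ i.1 w) ∈
            survival C κ' (i.1 + 1) (update (extend i.1 i.2) i.1 b) := by
        intro i
        by_cases hi : i.1 = N
        · subst hi
          obtain ⟨e, he⟩ := (mem_survival.1 (hleaf (extend i.1 i.2))).2 κ' hκ'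
          obtain ⟨w, rfl⟩ := hψs _ e
          exact ⟨w, fun _ => he⟩
        · exact ⟨0, fun h => absurd h hi⟩
      choose w hw using hw
      let p : J → ℕ := fun j => Sum.elim (fun i => if i.1 = N then w i j.2 else q j)
        (fun _ => q j) j.1
      have hp : ∀ y, leaf p y ∈ survival C κ' (N + 1) y := by
        intro y
        refine survival_congr ?_ ?_ (hw ⟨N, initial N y⟩ rfl (y N))
        · exact update_eq_of_lt fun t ht => extend_initial_of_lt y ht
        · have : ψ N (w ⟨N, initial N y⟩) = leaf p y N := by simp [leaf, p]
          rw [this]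
          refine update_eq_of_lt fun t ht => leaf_congr ?_ ?_
          · exact fun s hs => extend_initial_of_lt y (hs.trans ht)
          · intro u m
            simp [p, ht.ne]
      have hz : ∀ i : I, ∃ z : ℕ → ℕ, i.1 = N + 1 →
          (z, initial i.1 (leaf p (extend i.1 i.2))) ∈ K i.1 i.2 := by
        intro i
        by_cases hi : i.1 = N + 1
        · have := (mem_survival.1 (hp (extend i.1 i.2))).1
          rw [← hi, initial_extend] at this
          obtain ⟨z, hz⟩ := (hCK _ _ _).1 this
          exact ⟨z, fun _ => hz⟩
        · exact ⟨0, fun h => absurd h hi⟩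
      choose z hz using hz
      let q' : J → ℕ := fun j => Sum.elim (fun _ => p j)
        (fun i => if i.1 = N + 1 then z i j.2 else p j) j.1
      have hleaf' : leaf q' = leaf p := rfl
      have hq' : q' ∈ G (N + 1) := by
        intro n hn y
        rw [hleaf']
        obtain hn | rfl := Nat.le_succ_iff.1 hn
        · convert hq n hn y using 2
          · funext m
            simp [witness, q', p, (Nat.lt_succ_of_le hn).ne]
          · refine initial_congr fun t ht => leaf_congr (fun _ _ => rfl) fun u m => ?_
            simp [p, (ht.trans_le hn).ne]
        · convert hz ⟨N + 1, initial (N + 1) y⟩ rfl using 2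
          · funext m
            simp [witness, q']
          · exact initial_congr fun t ht => leaf_congr
              (fun s hs => (extend_initial_of_lt y (hs.trans ht)).symm) fun _ _ => rfl
      refine (ih κ' hκ' (N + 1) q' hq' (by rwa [hleaf'])).trans_lt (hρ N q q' ?_ hq')
      rintro ⟨i | i, m⟩ hj
      · have : i.1 + 1 ≤ N := hj.1
        simp [q', p, (Nat.lt_of_succ_le this).ne]
      · have : i.1 ≤ N := hj.1
        simp [q', p, (Nat.lt_succ_of_le this).ne]
  refine ⟨κ, hκ, fun ξ y hξ => ?_⟩
  obtain ⟨z, hz⟩ := (hCK _ _ _).1 (mem_survival.1 hξ).1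
  refine (hρκ 0 fun j => z j.2).not_ge (main κ 0 _ ?_ fun y' => ?_)
  · intro n hn y'
    obtain rfl := Nat.le_zero.1 hn
    convert hz
  · exact survival_congr (fun t ht => absurd ht t.not_lt_zero)
      (fun t ht => absurd ht t.not_lt_zero) hξ

/-- The replies of the second player following the positional strategy `step`. -/
def replies (step : ∀ n, (∀ j : Fin n, B j) → (∀ j : Fin (n + 1), E j) → B n) (n : ℕ)
    (ξ : ∀ t, E t) : B n :=
  step n (fun j => replies step j ξ) (initial (n + 1) ξ)
termination_by n
decreasing_by exact j.2

theorem replies_congr {step : ∀ n, (∀ j : Fin n, B j) → (∀ j : Fin (n + 1), E j) → B n} {n : ℕ}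
    {ξ ξ' : ∀ t, E t} (h : ∀ t < n + 1, ξ t = ξ' t) : replies step n ξ = replies step n ξ' := by
  induction n using Nat.strong_induction_on with
  | _ n ih =>
    rw [replies, replies, initial_congr h]
    congr 1
    exact funext fun j => ih j j.2 fun t ht => h t (ht.trans (Nat.succ_lt_succ j.2))

theorem universallyMeasurableSet_replies [∀ t, MeasurableSpace (E t)] [∀ t, Finite (B t)]
    {step : ∀ n, (∀ j : Fin n, B j) → (∀ j : Fin (n + 1), E j) → B n}
    (hstep : ∀ n u b, UniversallyMeasurableSet {v | step n u v = b}) (n : ℕ) (b : B n) :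
    UniversallyMeasurableSet {ξ | replies step n ξ = b} := by
  induction n using Nat.strong_induction_on with
  | _ n ih =>
    have : {ξ | replies step n ξ = b} = ⋃ u : ∀ j : Fin n, B j,
        (⋂ j : Fin n, {ξ | replies step j ξ = u j}) ∩ initial (n + 1) ⁻¹' {v | step n u v = b} := by
      ext ξ
      simp only [mem_iUnion, mem_inter_iff, mem_iInter, mem_preimage, mem_ofPred_eq]
      constructor
      · intro h
        rw [replies] at h
        exact ⟨fun j => replies step j ξ, fun _ => rfl, h⟩
      · rintro ⟨u, hu, h⟩
        rw [replies, ← h]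
        congr 1
        exact funext hu
    rw [this]
    refine .iUnion fun u => .inter (.iInter fun j => ih j j.2 _) ((hstep n u b).preimage ?_)
    exact measurable_pi_lambda _ fun j => measurable_pi_apply _

/-- If the first player cannot survive forever along a tree of moves, then the second player has a
universally measurable winning strategy. -/
theorem exists_universallyMeasurable_winning_strategy [∀ t, TopologicalSpace (E t)]
    [∀ t, PolishSpace (E t)] [∀ t, MeasurableSpace (E t)] [∀ t, BorelSpace (E t)]
    [∀ t, Inhabited (E t)] [∀ t, Finite (B t)] [∀ t, Inhabited (B t)]
    (hC : ∀ n u, AnalyticSet (C n u))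
    (htree : ¬ ∃ x : ∀ k, (∀ j : Fin k, B j) → E k, ∀ (y : ∀ t, B t) (n : ℕ),
      (fun k : Fin n => x k (initial k y)) ∈ C n (initial n y)) :
    ∃ η : ∀ n, (∀ j : Fin (n + 1), E j) → B n,
      (∀ n b, UniversallyMeasurableSet {v | η n v = b}) ∧
      ∀ ξ : ∀ t, E t, ∃ n, initial n ξ ∉ C n (fun j => η j (initial (j + 1) ξ)) := by
  obtain ⟨κ, hκ, hempty⟩ := exists_countable_forall_notMem_survival hC htree
  have : Countable (Iio κ) := hκ
  let V : ∀ n, (∀ j : Fin n, B j) → Ordinal.{0} → B n → Set (∀ j : Fin (n + 1), E j) :=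
    fun n u o b => extend (n + 1) ⁻¹' survival C o (n + 1) (update (extend n u) n b)
  let S : ∀ n, (∀ j : Fin n, B j) → B n → Set (∀ j : Fin (n + 1), E j) := fun n u b =>
    ⋂ o : Iio κ, ⋂ b', {v | v ∈ V n u o b → v ∈ V n u o b'}
  have hS : ∀ n u b, UniversallyMeasurableSet (S n u b) := by
    intro n u b
    have hV : ∀ (o : Iio κ) b, UniversallyMeasurableSet (V n u o b) := fun o b =>
      ((analyticSet_survival hC (hκ.mono (Iio_subset_Iio o.2.le)) _ _).preimage
        (continuous_extend _)).universallyMeasurableSet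
    exact .iInter fun o => .iInter fun b' => (hV o b).imp (hV o b')
  have hcover : ∀ n u v, ∃ b, v ∈ S n u b := by
    intro n u v
    by_cases h : ∃ o : Ordinal.{0}, ∃ b, v ∉ V n u o b
    · obtain ⟨o, ⟨b, hb⟩, hmin⟩ := wellFounded_lt.has_min {o : Ordinal.{0} | ∃ b, v ∉ V n u o b} h
      refine ⟨b, mem_iInter.2 fun o' => mem_iInter.2 fun b' hb' => ?_⟩
      by_contra hv
      exact hb (survival_anti (not_lt.1 (hmin _ ⟨b', hv⟩)) _ _ hb')
    · push Not at h
      exact ⟨default, mem_iInter.2 fun o => mem_iInter.2 fun b' _ => h o b'⟩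
  choose step hstep hstepS using fun n u =>
    UniversallyMeasurableSet.exists_selector (hS n u) (hcover n u)
  refine ⟨fun n v => replies step n (extend (n + 1) v), fun n b =>
    (universallyMeasurableSet_replies hstep n b).preimage (continuous_extend _).measurable,
    fun ξ => ?_⟩
  let y : ∀ t, B t := fun t => replies step t ξ
  have hy : ∀ n, (fun j : Fin n => replies step j (extend (j + 1) (initial (j + 1) ξ))) =
      initial n y := fun n =>
    funext fun j => replies_congr fun t ht => extend_initial_of_lt ξ ht
  by_contra! hsurv
  simp only [hy] at hsurv
  have hdescent : ∀ o ≤ κ, ∀ n, ξ ∈ survival C o n y := by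
    intro o
    induction o using WellFoundedLT.induction with
    | ind o ih =>
      intro ho n
      by_contra hn
      rw [mem_survival] at hn
      push Not at hn
      obtain ⟨o', ho', h⟩ := hn (hsurv n)
      obtain ⟨b, hb⟩ := h (ξ n)
      rw [update_eq_self] at hb
      refine hb ?_
      have hmem := mem_iInter.1 (mem_iInter.1 (hstepS n (initial n y) (initial (n + 1) ξ))
        ⟨o', ho'.trans_le ho⟩) b
      have hpast : ∀ t < n, extend n (initial n y) t = y t := fun t => extend_initial_of_lt y
      have hyn : step n (initial n y) (initial (n + 1) ξ) = y n := by
        simp only [y]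
        rw [replies]
      refine survival_congr (update_congr_of_lt hpast b)
        (fun t => extend_initial_of_lt ξ) (hmem ?_)
      rw [hyn]
      exact survival_congr (fun t ht => (update_eq_of_lt hpast t ht).symm)
        (fun t ht => (extend_initial_of_lt ξ ht).symm) (ih o' ho' (ho'.le.trans ho) (n + 1))
  exact hempty ξ y (hdescent κ le_rfl 0)

end OpenGame

end

/-- **Lemma 5.1.** If a measurable concept class `ℋ` on a Polish space has no infinite VCL tree,
then player `P_L` has a winning strategy in the game `𝔙` given by universally measurable maps
`η_τ : 𝒳^1 × 𝒳^2 × ⋯ × 𝒳^τ → {0,1}^τ`: against any sequence of plays `ξ_τ ∈ 𝒳^τ` of `P_A`,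
at some finite round `τ` the class `ℋ_{ξ_1,η_1,…,ξ_τ,η_τ}` becomes empty. -/
theorem pl_has_universally_measurable_winning_strategy_vcl
    (𝒳 : Type*) [TopologicalSpace 𝒳] [PolishSpace 𝒳] [MeasurableSpace 𝒳] [BorelSpace 𝒳]
    (ℋ : Set (𝒳 → Bool)) (hmeas : MeasurableClass 𝒳 ℋ)
    (htree : ¬ HasInfiniteVCLTree ℋ) :
    ∃ η : ∀ τ : ℕ, (∀ s : Fin (τ + 1), Fin (s.val + 1) → 𝒳) → Fin (τ + 1) → Bool,
      (∀ τ : ℕ, UniversallyMeasurable (η τ)) ∧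
      ∀ ξ : ∀ t : ℕ, Fin (t + 1) → 𝒳, ∃ τ : ℕ, ∀ h ∈ ℋ,
        ∃ s ≤ τ, ∃ i : Fin (s + 1),
          h (ξ s i) ≠ η s (fun r : Fin (s + 1) => ξ r.val) i := by
  classical
  obtain ⟨w⟩ := hmeas
  let _ := w.tΘ
  let _ := w.mΘ
  have _ := w.polish
  have _ := w.borel
  cases isEmpty_or_nonempty 𝒳 with
  | inl h =>
    refine ⟨fun _ _ _ => false, fun τ μ _ => measurable_const.nullMeasurable, fun ξ => ?_⟩
    exact h.elim (ξ 0 0)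
  | inr h =>
    have := Classical.inhabited_of_nonempty h
    let C : ∀ n, (∀ j : Fin n, Fin (j + 1) → Bool) → Set (∀ j : Fin n, Fin (j + 1) → 𝒳) :=
      fun n u => Prod.snd '' {p : w.Θ × (∀ j : Fin n, Fin (j + 1) → 𝒳) |
        ∀ j i, w.f p.1 (p.2 j i) = u j i}
    have hC : ∀ n u, MeasureTheory.AnalyticSet (C n u) := by
      intro n u
      refine (MeasurableSet.analyticSet ?_).image_of_continuous continuous_snd
      simp only [Set.ofPred_forall]
      refine .iInter fun j => .iInter fun i => ?_
      have hm : Measurable fun p : w.Θ × (∀ j : Fin n, Fin (j + 1) → 𝒳) => w.f p.1 (p.2 j i) :=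
        w.meas.comp (measurable_fst.prodMk (by fun_prop))
      exact hm (measurableSet_singleton (u j i))
    obtain ⟨η, hη, hwin⟩ := OpenGame.exists_universallyMeasurable_winning_strategy
      (E := fun t => Fin (t + 1) → 𝒳) (B := fun t => Fin (t + 1) → Bool) hC (by
        rintro ⟨x, hx⟩
        refine htree ⟨x, fun y n => ?_⟩
        obtain ⟨⟨θ, _⟩, hθ, rfl⟩ := hx y (n + 1)
        refine ⟨w.f θ, w.range_eq.symm.subset ⟨θ, rfl⟩, fun k hk i => hθ ⟨k, Nat.lt_succ_of_le hk⟩ i⟩)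
    refine ⟨η, fun τ => .of_fiber (hη τ), fun ξ => ?_⟩
    obtain ⟨n, hn⟩ := hwin ξ
    refine ⟨n, fun h hh => ?_⟩
    rw [w.range_eq] at hh
    obtain ⟨θ, rfl⟩ := hh
    by_contra! hcon
    exact hn ⟨(θ, OpenGame.initial n ξ), fun j i => hcon j j.2.le i, rfl⟩
end
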